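/- arXiv:0904.2514 — 3 statements merged into one kernel-verified Lean document; each statement's English description precedes it below -/
import Mathlib

section
/- The Szegő function D(·, w) of the analytic Jacobi-type weight w(x) = h(x)(1-x)^α(1+x)^β has the following boundary behavior: for every x ∈ (-1,1), lim_{z→x, Im z>0} D(z, w) = √(w(x))·exp(iΦ(x)) and lim_{z→x, Im z<0} D(z, w) = √(w(x))·exp(−iΦ(x)), where Φ(x) = πα/2 − ((α+β)/2)·arccos(x) − ħ(x). -/
open Filter Set MeasureTheory

lemma setIntegral_inv_sqrt_smul_eq_cos {E : Type*} [NormedAddCommGroup E] [NormedSpace ℝ E]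
    (f : ℝ → E) :
    ∫ t in Ioo (-1 : ℝ) 1, (Real.sqrt (1 - t ^ 2))⁻¹ • f t =
      ∫ θ in Ioo 0 Real.pi, f (Real.cos θ) := by
  have himg : Set.image Real.cos (Ioo 0 Real.pi) = Ioo (-1) 1 := by
    ext t
    constructor
    · rintro ⟨θ, hθ, rfl⟩
      constructor
      · rw [← Real.cos_pi]
        exact Real.cos_lt_cos_of_nonneg_of_le_pi hθ.1.le le_rfl hθ.2
      · rw [← Real.cos_zero]
        exact Real.cos_lt_cos_of_nonneg_of_le_pi le_rfl hθ.2.le hθ.1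
    · intro ht
      exact ⟨Real.arccos t, ⟨Real.arccos_pos.2 ht.2, Real.arccos_lt_pi.2 ht.1⟩,
        Real.cos_arccos ht.1.le ht.2.le⟩
  rw [← himg, integral_image_eq_integral_abs_deriv_smul measurableSet_Ioo
    (fun θ _ => (Real.hasDerivAt_cos θ).hasDerivWithinAt)
    (Real.injOn_cos.mono Ioo_subset_Icc_self)]
  refine setIntegral_congr_fun measurableSet_Ioo fun θ hθ => ?_
  have hs := Real.sin_pos_of_pos_of_lt_pi hθ.1 hθ.2
  have h1 : Real.sqrt (1 - Real.cos θ ^ 2) = Real.sin θ := by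
    rw [← Real.sin_sq, Real.sqrt_sq hs.le]
  simp only [h1, smul_smul, abs_neg, abs_of_pos hs, mul_inv_cancel₀ hs.ne', one_smul]

lemma poissonDenom_eq (ζ : ℂ) (θ : ℝ) :
    1 - 2 * ζ * (Real.cos θ : ℂ) + ζ ^ 2 =
      (1 - ζ * Complex.exp (θ * Complex.I)) * (1 - ζ * Complex.exp (-(θ * Complex.I))) := by
  have h1 : Complex.exp (θ * Complex.I) * Complex.exp (-(θ * Complex.I)) = 1 := by
    rw [← Complex.exp_add, add_neg_cancel, Complex.exp_zero]
  rw [Complex.ofReal_cos, Complex.cos, neg_mul]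
  linear_combination (-ζ ^ 2) * h1

lemma one_sub_mul_ne_zero_of_norm_lt_one {a b : ℂ} (ha : ‖a‖ < 1) (hb : ‖b‖ ≤ 1) :
    1 - a * b ≠ 0 := by
  intro h
  have h1 : ‖a * b‖ = 1 := by rw [← sub_eq_zero.1 h, norm_one]
  rw [norm_mul] at h1
  nlinarith [norm_nonneg a, norm_nonneg b]

lemma norm_exp_neg_ofReal_mul_I (θ : ℝ) : ‖Complex.exp (-(θ * Complex.I))‖ = 1 := by
  simpa using Complex.norm_exp_ofReal_mul_I (-θ)

lemma poissonDenom_ne_zero {ζ : ℂ} (hζ : ‖ζ‖ < 1) (θ : ℝ) :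
    1 - 2 * ζ * (Real.cos θ : ℂ) + ζ ^ 2 ≠ 0 := by
  rw [poissonDenom_eq]
  exact mul_ne_zero
    (one_sub_mul_ne_zero_of_norm_lt_one hζ (Complex.norm_exp_ofReal_mul_I θ).le)
    (one_sub_mul_ne_zero_of_norm_lt_one hζ (norm_exp_neg_ofReal_mul_I θ).le)

lemma continuous_poisson {ζ : ℂ} (hζ : ‖ζ‖ < 1) :
    Continuous fun θ : ℝ => (1 - ζ ^ 2) / (1 - 2 * ζ * (Real.cos θ : ℂ) + ζ ^ 2) := by
  refine Continuous.div (by fun_prop) (by fun_prop) fun θ => poissonDenom_ne_zero hζ θ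

lemma integral_mul_poisson {g : ℂ → ℂ} (hg : DifferentiableOn ℂ g (Metric.closedBall 0 1))
    {ζ : ℂ} (hζ : ‖ζ‖ < 1) :
    ∫ θ in (0 : ℝ)..2 * Real.pi, g (Complex.exp (θ * Complex.I)) *
      ((1 - ζ ^ 2) / (1 - 2 * ζ * (Real.cos θ : ℂ) + ζ ^ 2)) = 2 * Real.pi * g ζ := by
  have hG : DifferentiableOn ℂ (fun u => g u * ((1 - ζ ^ 2) / (1 - ζ * u)))
      (Metric.closedBall 0 1) := by
    refine hg.mul (DifferentiableOn.div (by fun_prop) (by fun_prop) fun u hu => ?_)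
    exact one_sub_mul_ne_zero_of_norm_lt_one hζ (by simpa using hu)
  have h := hG.circleIntegral_sub_inv_smul (w := ζ) (by simpa using hζ)
  have hne : 1 - ζ ^ 2 ≠ 0 := by
    rw [sq]; exact one_sub_mul_ne_zero_of_norm_lt_one hζ hζ.le
  rw [show 1 - ζ * ζ = 1 - ζ ^ 2 by ring, div_self hne, mul_one, circleIntegral] at h
  have h2 : ∀ θ : ℝ, deriv (circleMap 0 1) θ • (circleMap 0 1 θ - ζ)⁻¹ •
      (g (circleMap 0 1 θ) * ((1 - ζ ^ 2) / (1 - ζ * circleMap 0 1 θ))) =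
      Complex.I * (g (Complex.exp (θ * Complex.I)) *
      ((1 - ζ ^ 2) / (1 - 2 * ζ * (Real.cos θ : ℂ) + ζ ^ 2))) := by
    intro θ
    rw [poissonDenom_eq]
    have hn1 := one_sub_mul_ne_zero_of_norm_lt_one hζ (Complex.norm_exp_ofReal_mul_I θ).le
    have hn2 := one_sub_mul_ne_zero_of_norm_lt_one hζ (norm_exp_neg_ofReal_mul_I θ).le
    simp only [deriv_circleMap, circleMap, Complex.ofReal_one, one_mul, zero_add, smul_eq_mul]
    rw [Complex.exp_neg] at hn2 ⊢
    have he := Complex.exp_ne_zero (θ * Complex.I)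
    set e := Complex.exp (θ * Complex.I)
    have hn3 : e - ζ ≠ 0 := by
      intro h; apply hn2; rw [← sub_eq_zero.1 h, mul_inv_cancel₀ he, sub_self]
    have : 1 - ζ * e⁻¹ = (e - ζ) / e := by field_simp
    rw [this]
    field_simp
  rw [intervalIntegral.integral_congr (fun θ _ => h2 θ), intervalIntegral.integral_const_mul,
    smul_eq_mul] at h
  refine mul_left_cancel₀ Complex.I_ne_zero (h.trans ?_)
  ring

lemma integral_symm_mul_poisson {g : ℂ → ℂ}
    (hg : DifferentiableOn ℂ g (Metric.closedBall 0 1)) {ζ : ℂ} (hζ : ‖ζ‖ < 1) :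
    ∫ θ in (0 : ℝ)..Real.pi,
      (g (Complex.exp (θ * Complex.I)) + g (Complex.exp (-(θ * Complex.I)))) *
      ((1 - ζ ^ 2) / (1 - 2 * ζ * (Real.cos θ : ℂ) + ζ ^ 2)) = 2 * Real.pi * g ζ := by
  rw [← integral_mul_poisson hg hζ]
  have hc1 : Continuous fun θ : ℝ => g (Complex.exp (θ * Complex.I)) *
      ((1 - ζ ^ 2) / (1 - 2 * ζ * (Real.cos θ : ℂ) + ζ ^ 2)) := by
    refine Continuous.mul ?_ (continuous_poisson hζ)
    exact hg.continuousOn.comp_continuous (by fun_prop) fun θ => by simp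
  have hc2 : Continuous fun θ : ℝ => g (Complex.exp (-(θ * Complex.I))) *
      ((1 - ζ ^ 2) / (1 - 2 * ζ * (Real.cos θ : ℂ) + ζ ^ 2)) := by
    refine Continuous.mul ?_ (continuous_poisson hζ)
    exact hg.continuousOn.comp_continuous (by fun_prop) fun θ => by
      simp [norm_exp_neg_ofReal_mul_I]
  simp only [add_mul]
  rw [intervalIntegral.integral_add (hc1.intervalIntegrable _ _) (hc2.intervalIntegrable _ _),
    ← intervalIntegral.integral_add_adjacent_intervals (hc1.intervalIntegrable 0 Real.pi)
      (hc1.intervalIntegrable Real.pi (2 * Real.pi))]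
  congr 1
  have := intervalIntegral.integral_comp_sub_left (a := 0) (b := Real.pi)
    (fun θ : ℝ => g (Complex.exp (θ * Complex.I)) *
      ((1 - ζ ^ 2) / (1 - 2 * ζ * (Real.cos θ : ℂ) + ζ ^ 2))) (2 * Real.pi)
  rw [show 2 * Real.pi - Real.pi = Real.pi by ring, sub_zero] at this
  rw [← this]
  refine intervalIntegral.integral_congr fun θ _ => ?_
  have : Complex.exp (((2 * Real.pi - θ : ℝ) : ℂ) * Complex.I) =
      Complex.exp (-(θ * Complex.I)) := by
    rw [← Complex.exp_periodic (-(θ * Complex.I))]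
    congr 1
    push_cast
    ring
  simp only [this, Real.cos_two_pi_sub]

lemma integral_poisson {ζ : ℂ} (hζ : ‖ζ‖ < 1) :
    ∫ θ in (0 : ℝ)..Real.pi, (1 - ζ ^ 2) / (1 - 2 * ζ * (Real.cos θ : ℂ) + ζ ^ 2) =
      (Real.pi : ℂ) := by
  have := integral_symm_mul_poisson (g := fun _ => 1 / 2) (by fun_prop) hζ
  norm_num [-Complex.ofReal_cos] at this
  exact this.trans (by ring)

lemma integral_log_mul_poisson_of_lt_one {r : ℝ} (hr0 : 0 ≤ r) (hr1 : r < 1) {ζ : ℂ}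
    (hζ : ‖ζ‖ < 1) :
    ∫ θ in (0 : ℝ)..Real.pi, (Real.log (1 - 2 * r * Real.cos θ + r ^ 2) : ℂ) *
      ((1 - ζ ^ 2) / (1 - 2 * ζ * (Real.cos θ : ℂ) + ζ ^ 2)) =
      2 * Real.pi * Complex.log (1 - r * ζ) := by
  have hr : ‖(r : ℂ)‖ < 1 := by simpa [abs_of_nonneg hr0] using hr1
  have hslit : ∀ u : ℂ, ‖u‖ ≤ 1 → 1 - r * u ∈ Complex.slitPlane := by
    intro u hu
    have : ‖(r : ℂ) * u‖ < 1 := by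
      rw [norm_mul]; nlinarith [norm_nonneg u, norm_nonneg (r : ℂ)]
    left
    have := (Complex.abs_re_le_norm _).trans_lt this
    rw [Complex.sub_re, Complex.one_re]
    linarith [(abs_lt.1 this).2]
  rw [← integral_symm_mul_poisson (g := fun u => Complex.log (1 - r * u)) ?_ hζ]
  · refine intervalIntegral.integral_congr fun θ _ => ?_
    congr 1
    have hconj : Complex.exp (-(θ * Complex.I)) =
        (starRingEnd ℂ) (Complex.exp (θ * Complex.I)) := by
      rw [← Complex.exp_conj]; simp
    have h1 := hslit _ (Complex.norm_exp_ofReal_mul_I θ).le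
    have h2 : 1 - r * Complex.exp (-(θ * Complex.I)) =
        (starRingEnd ℂ) (1 - r * Complex.exp (θ * Complex.I)) := by
      rw [hconj]; simp
    have hd := poissonDenom_eq r θ
    rw [h2, Complex.mul_conj] at hd
    rw [h2, Complex.log_conj _ (Complex.slitPlane_arg_ne_pi h1), Complex.add_conj,
      Complex.log_re]
    have hd' : 1 - 2 * r * Real.cos θ + r ^ 2 =
        ‖1 - r * Complex.exp (θ * Complex.I)‖ ^ 2 := by
      rw [← Complex.normSq_eq_norm_sq]; exact_mod_cast hd
    rw [hd', Real.log_pow]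
    norm_num
  · refine DifferentiableOn.clog (by fun_prop) fun u hu => hslit u (by simpa using hu)

lemma intervalIntegrable_log_one_sub_cos (a b : ℝ) :
    IntervalIntegrable (fun θ => Real.log (1 - Real.cos θ)) volume a b :=
  MeromorphicOn.intervalIntegrable_log (f := fun θ => 1 - Real.cos θ)
    (analyticOnNhd_const.sub Real.analyticOnNhd_cos).meromorphicOn

lemma intervalIntegrable_log_one_add_cos (a b : ℝ) :
    IntervalIntegrable (fun θ => Real.log (1 + Real.cos θ)) volume a b :=
  MeromorphicOn.intervalIntegrable_log (f := fun θ => 1 + Real.cos θ)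
    (analyticOnNhd_const.add Real.analyticOnNhd_cos).meromorphicOn

lemma integral_log_one_sub_cos_mul_poisson {ζ : ℂ} (hζ : ‖ζ‖ < 1) :
    ∫ θ in (0 : ℝ)..Real.pi, (Real.log (1 - Real.cos θ) : ℂ) *
      ((1 - ζ ^ 2) / (1 - 2 * ζ * (Real.cos θ : ℂ) + ζ ^ 2)) =
      2 * Real.pi * Complex.log (1 - ζ) - Real.pi * Real.log 2 := by
  have hP := continuous_poisson hζ
  obtain ⟨C, hC⟩ := (isCompact_uIcc (a := 0) (b := Real.pi)).exists_bound_of_continuousOn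
    hP.continuousOn
  have hcos : ∀ θ ∈ Ioc 0 Real.pi, Real.cos θ < 1 := fun θ hθ => by
    rw [← Real.cos_zero]
    exact Real.cos_lt_cos_of_nonneg_of_le_pi le_rfl hθ.2 hθ.1
  have hlim : Tendsto (fun r : ℝ => ∫ θ in (0 : ℝ)..Real.pi,
      (Real.log (1 - 2 * r * Real.cos θ + r ^ 2) : ℂ) *
        ((1 - ζ ^ 2) / (1 - 2 * ζ * (Real.cos θ : ℂ) + ζ ^ 2))) (nhdsWithin 1 (Iio 1))
      (nhds (∫ θ in (0 : ℝ)..Real.pi, (Real.log (1 - 2 * 1 * Real.cos θ + 1 ^ 2) : ℂ) *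
        ((1 - ζ ^ 2) / (1 - 2 * ζ * (Real.cos θ : ℂ) + ζ ^ 2)))) := by
    refine intervalIntegral.tendsto_integral_filter_of_dominated_convergence
      (fun θ => (Real.log 4 + |Real.log (1 - Real.cos θ)|) * C) ?_ ?_ ?_ ?_
    · refine Eventually.of_forall fun r => Measurable.aestronglyMeasurable ?_
      exact Measurable.mul (by fun_prop) hP.measurable
    · have : Ioo (1 / 2 : ℝ) 1 ∈ nhdsWithin 1 (Iio 1) := Ioo_mem_nhdsLT (by norm_num)
      filter_upwards [this] with r hr
      refine ae_of_all _ fun θ hθ => ?_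
      have hθ' := hθ
      rw [uIoc_of_le Real.pi_pos.le] at hθ
      have hc := hcos θ hθ
      have hc' := Real.neg_one_le_cos θ
      rw [norm_mul]
      refine mul_le_mul ?_ (hC θ (uIoc_subset_uIcc hθ')) (norm_nonneg _) ?_
      · rw [Complex.norm_real, Real.norm_eq_abs]
        have hlow : 1 - Real.cos θ ≤ 1 - 2 * r * Real.cos θ + r ^ 2 := by
          nlinarith [hr.1, hr.2, sq_nonneg (1 - r), mul_nonneg (sub_nonneg.2 hr.1.le)
            (sub_nonneg.2 hc.le)]
        have hup : 1 - 2 * r * Real.cos θ + r ^ 2 ≤ 4 := by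
          nlinarith [hr.1, hr.2]
        have hl1 := Real.log_le_log (by linarith) hlow
        have hl2 := Real.log_le_log (by linarith) hup
        have h4 : 0 ≤ Real.log 4 := Real.log_nonneg (by norm_num)
        rw [abs_le]
        constructor
        · linarith [neg_abs_le (Real.log (1 - Real.cos θ))]
        · linarith [abs_nonneg (Real.log (1 - Real.cos θ))]
      · have h4 : 0 ≤ Real.log 4 := Real.log_nonneg (by norm_num)
        positivity
    · refine IntervalIntegrable.mul_const ?_ _
      exact intervalIntegrable_const.add (intervalIntegrable_log_one_sub_cos _ _).abs
    · refine ae_of_all _ fun θ hθ => ?_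
      rw [uIoc_of_le Real.pi_pos.le] at hθ
      have hc := hcos θ hθ
      refine Tendsto.mul_const _ ?_
      refine (Complex.continuous_ofReal.tendsto _).comp ?_
      refine tendsto_nhdsWithin_of_tendsto_nhds ?_
      have : ContinuousAt (fun r : ℝ => Real.log (1 - 2 * r * Real.cos θ + r ^ 2)) 1 := by
        refine ContinuousAt.log (by fun_prop) ?_
        nlinarith
      exact this.tendsto
  have hlim2 : Tendsto (fun r : ℝ => ∫ θ in (0 : ℝ)..Real.pi,
      (Real.log (1 - 2 * r * Real.cos θ + r ^ 2) : ℂ) *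
        ((1 - ζ ^ 2) / (1 - 2 * ζ * (Real.cos θ : ℂ) + ζ ^ 2))) (nhdsWithin 1 (Iio 1))
      (nhds (2 * Real.pi * Complex.log (1 - (1 : ℝ) * ζ))) := by
    have hc : ContinuousAt (fun r : ℝ => 2 * Real.pi * Complex.log (1 - r * ζ)) 1 := by
      refine ContinuousAt.mul (by fun_prop) (ContinuousAt.clog (by fun_prop) ?_)
      left
      have := (Complex.abs_re_le_norm _).trans_lt hζ
      simp only [Complex.ofReal_one, one_mul, Complex.sub_re, Complex.one_re]
      linarith [(abs_lt.1 this).2]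
    refine (hc.tendsto.mono_left nhdsWithin_le_nhds).congr' ?_
    have : Ioo (1 / 2 : ℝ) 1 ∈ nhdsWithin 1 (Iio 1) := Ioo_mem_nhdsLT (by norm_num)
    filter_upwards [this] with r hr
    exact (integral_log_mul_poisson_of_lt_one (by linarith [hr.1]) hr.2 hζ).symm
  have heq := tendsto_nhds_unique hlim hlim2
  rw [Complex.ofReal_one, one_mul] at heq
  have hint : IntervalIntegrable (fun θ : ℝ => (Real.log (1 - Real.cos θ) : ℂ) *
      ((1 - ζ ^ 2) / (1 - 2 * ζ * (Real.cos θ : ℂ) + ζ ^ 2))) volume 0 Real.pi :=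
    (IntervalIntegrable.mul_continuousOn (f := fun θ : ℝ => (Real.log (1 - Real.cos θ) : ℂ))
      ⟨(intervalIntegrable_log_one_sub_cos _ _).1.ofReal,
        (intervalIntegrable_log_one_sub_cos _ _).2.ofReal⟩ hP.continuousOn)
  rw [← heq, ← integral_poisson hζ, mul_comm _ (Real.log 2 : ℂ),
    ← intervalIntegral.integral_const_mul, eq_sub_iff_add_eq, ← intervalIntegral.integral_add
    hint ((hP.intervalIntegrable _ _).const_mul _)]
  refine intervalIntegral.integral_congr_ae (ae_of_all _ fun θ hθ => ?_)
  rw [uIoc_of_le Real.pi_pos.le] at hθ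
  have hc := hcos θ hθ
  rw [← add_mul, ← Complex.ofReal_add, ← Real.log_mul (by linarith) (by norm_num)]
  congr 3
  ring_nf

lemma integral_log_one_add_cos_mul_poisson {ζ : ℂ} (hζ : ‖ζ‖ < 1) :
    ∫ θ in (0 : ℝ)..Real.pi, (Real.log (1 + Real.cos θ) : ℂ) *
      ((1 - ζ ^ 2) / (1 - 2 * ζ * (Real.cos θ : ℂ) + ζ ^ 2)) =
      2 * Real.pi * Complex.log (1 + ζ) - Real.pi * Real.log 2 := by
  have h := integral_log_one_sub_cos_mul_poisson (ζ := -ζ) (by simpa using hζ)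
  rw [sub_neg_eq_add] at h
  rw [← h]
  have := intervalIntegral.integral_comp_sub_left (a := 0) (b := Real.pi)
    (fun θ : ℝ => (Real.log (1 + Real.cos θ) : ℂ) *
      ((1 - ζ ^ 2) / (1 - 2 * ζ * (Real.cos θ : ℂ) + ζ ^ 2))) Real.pi
  rw [sub_self, sub_zero] at this
  rw [← this]
  refine intervalIntegral.integral_congr fun θ _ => ?_
  simp only [Real.cos_pi_sub, Complex.ofReal_neg, ← sub_eq_add_neg]
  ring

lemma integrableOn_inv_sqrt_one_sub_sq :
    IntegrableOn (fun t : ℝ => (Real.sqrt (1 - t ^ 2))⁻¹) (Ioo (-1) 1) := by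
  have := Polynomial.Chebyshev.intervalIntegrable_sqrt_one_sub_sq_inv
  rw [intervalIntegrable_iff_integrableOn_Ioo_of_le (by norm_num)] at this
  simpa only [Real.sqrt_inv] using this

lemma integrableOn_inv_sqrt_mul_of_bound {S : Set ℝ} (hS : S ⊆ Ioo (-1) 1)
    (hSm : MeasurableSet S) {k : ℝ → ℝ} (hk : AEStronglyMeasurable k (volume.restrict S))
    {C : ℝ} (hC : ∀ t ∈ S, |k t| ≤ C) :
    IntegrableOn (fun t => (Real.sqrt (1 - t ^ 2))⁻¹ * k t) S := by
  refine Integrable.mul_bdd (c := C) (integrableOn_inv_sqrt_one_sub_sq.mono_set hS) hk ?_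
  filter_upwards [ae_restrict_mem hSm] with t ht
  exact hC t ht

lemma hasDerivAt_principalValue_primitive {x t : ℝ} (hx : x ∈ Ioo (-1 : ℝ) 1)
    (ht : t ∈ Ioo (-1 : ℝ) 1) (hne : t ≠ x) :
    HasDerivAt (fun t => -(Real.sqrt (1 - x ^ 2))⁻¹ *
      (Real.log (1 - x * t + Real.sqrt (1 - x ^ 2) * Real.sqrt (1 - t ^ 2)) - Real.log (t - x)))
      ((Real.sqrt (1 - t ^ 2))⁻¹ / (t - x)) t := by
  have hx2 : 0 < 1 - x ^ 2 := by nlinarith [hx.1, hx.2]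
  have ht2 : 0 < 1 - t ^ 2 := by nlinarith [ht.1, ht.2]
  have hs := Real.sqrt_pos.2 hx2
  have hq := Real.sqrt_pos.2 ht2
  have hs2 := Real.sq_sqrt hx2.le
  have hq2 := Real.sq_sqrt ht2.le
  have hN : 0 < 1 - x * t + Real.sqrt (1 - x ^ 2) * Real.sqrt (1 - t ^ 2) := by
    nlinarith [mul_pos hs hq, sq_nonneg (x - t), sq_nonneg (x + t)]
  have hd1 : HasDerivAt (fun t : ℝ => 1 - t ^ 2) (-(2 * t)) t := by
    simpa using (hasDerivAt_pow 2 t).const_sub 1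
  have hd2 := hd1.sqrt ht2.ne'
  have hd3 : HasDerivAt (fun t : ℝ => 1 - x * t) (-x) t := by
    simpa using ((hasDerivAt_id t).const_mul x).const_sub 1
  have hd4 := (hd3.add (hd2.const_mul (Real.sqrt (1 - x ^ 2)))).log hN.ne'
  have hd5 := ((hasDerivAt_id t).sub_const x).log (sub_ne_zero.2 hne)
  refine ((hd4.sub hd5).const_mul (-(Real.sqrt (1 - x ^ 2))⁻¹)).congr_deriv ?_
  simp only [id, Pi.add_apply]
  set s := Real.sqrt (1 - x ^ 2)
  set q := Real.sqrt (1 - t ^ 2)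
  have hne' : t - x ≠ 0 := sub_ne_zero.2 hne
  have hN' := hN.ne'
  field_simp
  linear_combination (-q) * hs2 + s * hq2

lemma continuousOn_principalValue_primitive {x : ℝ} (hx : x ∈ Ioo (-1 : ℝ) 1) :
    ContinuousOn (fun t => -(Real.sqrt (1 - x ^ 2))⁻¹ *
      (Real.log (1 - x * t + Real.sqrt (1 - x ^ 2) * Real.sqrt (1 - t ^ 2)) - Real.log (t - x)))
      (Icc (-1) 1 \ {x}) := by
  refine ContinuousOn.mul (by fun_prop) (ContinuousOn.sub (ContinuousOn.log (by fun_prop) ?_)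
    (ContinuousOn.log (by fun_prop) ?_))
  · rintro t ⟨ht, -⟩
    have : 0 < 1 - x * t := by
      have : |x * t| < 1 := by
        rw [abs_mul]
        nlinarith [abs_lt.2 hx, abs_le.2 ht, abs_nonneg x, abs_nonneg t]
      linarith [(abs_lt.1 this).2]
    positivity
  · rintro t ⟨-, ht⟩
    exact sub_ne_zero.2 ht

lemma integral_inv_sqrt_div_sub {x a b : ℝ} (hx : x ∈ Ioo (-1 : ℝ) 1) (ha : -1 ≤ a)
    (hab : a ≤ b) (hb : b ≤ 1) (hxab : x ∉ Icc a b) :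
    ∫ t in a..b, (Real.sqrt (1 - t ^ 2))⁻¹ / (t - x) =
      -(Real.sqrt (1 - x ^ 2))⁻¹ *
      (Real.log (1 - x * b + Real.sqrt (1 - x ^ 2) * Real.sqrt (1 - b ^ 2)) - Real.log (b - x)) -
      -(Real.sqrt (1 - x ^ 2))⁻¹ *
      (Real.log (1 - x * a + Real.sqrt (1 - x ^ 2) * Real.sqrt (1 - a ^ 2)) -
        Real.log (a - x)) := by
  refine intervalIntegral.integral_eq_sub_of_hasDerivAt_of_le hab
    ((continuousOn_principalValue_primitive hx).mono fun t ht =>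
      ⟨⟨ha.trans ht.1, ht.2.trans hb⟩, fun h => hxab (h ▸ ht)⟩)
    (fun t ht => hasDerivAt_principalValue_primitive hx
      ⟨ha.trans_lt ht.1, ht.2.trans_le hb⟩ fun h => hxab (h ▸ Ioo_subset_Icc_self ht)) ?_
  simp only [div_eq_mul_inv]
  refine IntervalIntegrable.mul_continuousOn ?_ ?_
  · rw [intervalIntegrable_iff_integrableOn_Ioo_of_le hab]
    exact integrableOn_inv_sqrt_one_sub_sq.mono_set (Ioo_subset_Ioo ha hb)
  · refine ContinuousOn.inv₀ (by fun_prop) fun t ht => ?_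
    rw [uIcc_of_le hab] at ht
    exact sub_ne_zero.2 fun h => hxab (h ▸ ht)

lemma integrableOn_inv_sqrt_div_sub {x ε : ℝ} (hε : 0 < ε) {S : Set ℝ}
    (hS : S ⊆ Ioo (-1) 1) (hSx : ∀ t ∈ S, t ∉ Ioo (x - ε) (x + ε)) (hSm : MeasurableSet S) :
    IntegrableOn (fun t => (Real.sqrt (1 - t ^ 2))⁻¹ / (t - x)) S := by
  simp only [div_eq_mul_inv]
  refine integrableOn_inv_sqrt_mul_of_bound hS hSm
    (by fun_prop : Measurable fun t => (t - x)⁻¹).aestronglyMeasurable (C := ε⁻¹)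
    fun t ht => ?_
  rw [abs_inv]
  refine inv_anti₀ hε ?_
  by_contra! hlt
  rw [abs_lt] at hlt
  exact hSx t ht ⟨by linarith, by linarith⟩

lemma tendsto_principalValue_inv_sqrt {x : ℝ} (hx : x ∈ Ioo (-1 : ℝ) 1) :
    Tendsto (fun ε : ℝ => ∫ t in (Ioo (-1 : ℝ) 1 \ Ioo (x - ε) (x + ε)),
      (Real.sqrt (1 - t ^ 2))⁻¹ / (t - x)) (nhdsWithin 0 (Ioi 0)) (nhds 0) := by
  have hx2 : 0 < 1 - x ^ 2 := by nlinarith [hx.1, hx.2]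
  set N : ℝ → ℝ := fun t =>
    Real.log (1 - x * t + Real.sqrt (1 - x ^ 2) * Real.sqrt (1 - t ^ 2)) with hN
  have hNc : ContinuousAt N x := by
    refine ContinuousAt.log (by fun_prop) ?_
    have : 0 ≤ Real.sqrt (1 - x ^ 2) * Real.sqrt (1 - x ^ 2) := by positivity
    nlinarith
  have hlim : Tendsto (fun ε : ℝ => -(Real.sqrt (1 - x ^ 2))⁻¹ * (N (x - ε) - N (x + ε)))
      (nhdsWithin 0 (Ioi 0)) (nhds 0) := by
    have h1 : ContinuousAt (fun ε : ℝ => -(Real.sqrt (1 - x ^ 2))⁻¹ * (N (x - ε) - N (x + ε)))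
        0 := by
      refine ContinuousAt.mul (by fun_prop) (ContinuousAt.sub ?_ ?_)
      · exact ContinuousAt.comp (g := N) (by simpa using hNc) (by fun_prop)
      · exact ContinuousAt.comp (g := N) (by simpa using hNc) (by fun_prop)
    have h2 := h1.tendsto
    simp only [sub_zero, add_zero, sub_self, mul_zero] at h2
    exact h2.mono_left nhdsWithin_le_nhds
  refine hlim.congr' ?_
  have hmem : Ioo 0 (min (1 - x) (1 + x)) ∈ nhdsWithin (0 : ℝ) (Ioi 0) :=
    Ioo_mem_nhdsGT (lt_min (by linarith [hx.2]) (by linarith [hx.1]))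
  filter_upwards [hmem] with ε hε
  have hε0 := hε.1
  have h1 := hε.2.trans_le (min_le_left _ _)
  have h2 := hε.2.trans_le (min_le_right _ _)
  have hset : Ioo (-1 : ℝ) 1 \ Ioo (x - ε) (x + ε) = Ioc (-1) (x - ε) ∪ Ico (x + ε) 1 := by
    ext t
    simp only [Set.mem_sdiff, mem_Ioo, mem_union, mem_Ioc, mem_Ico, not_and_or, not_lt]
    constructor
    · rintro ⟨⟨h3, h4⟩, h5 | h5⟩
      · exact Or.inl ⟨h3, h5⟩
      · exact Or.inr ⟨h5, h4⟩
    · rintro (⟨h3, h4⟩ | ⟨h3, h4⟩)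
      · exact ⟨⟨h3, by linarith⟩, Or.inl h4⟩
      · exact ⟨⟨by linarith, h4⟩, Or.inr h3⟩
  have hint : ∀ S ⊆ Ioo (-1 : ℝ) 1 \ Ioo (x - ε) (x + ε), MeasurableSet S →
      IntegrableOn (fun t => (Real.sqrt (1 - t ^ 2))⁻¹ / (t - x)) S := fun S hS hSm =>
    integrableOn_inv_sqrt_div_sub hε0 (fun t ht => (hS ht).1) (fun t ht => (hS ht).2) hSm
  rw [hset, setIntegral_union (by
      rw [Set.disjoint_left]
      rintro t ⟨-, h3⟩ ⟨h4, -⟩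
      linarith) measurableSet_Ico (hint _ (hset ▸ subset_union_left) measurableSet_Ioc)
      (hint _ (hset ▸ subset_union_right) measurableSet_Ico),
    integral_Ico_eq_integral_Ioc, ← intervalIntegral.integral_of_le (by linarith),
    ← intervalIntegral.integral_of_le (by linarith),
    integral_inv_sqrt_div_sub hx le_rfl (by linarith) (by linarith)
      (fun h => by linarith [h.2]),
    integral_inv_sqrt_div_sub hx (by linarith) (by linarith) le_rfl
      (fun h => by linarith [h.1])]
  have e1 : Real.log (x - ε - x) = Real.log ε := by
    rw [show x - ε - x = -ε by ring, Real.log_neg_eq_log]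
  have e2 : Real.log (-1 - x) = Real.log (1 + x) := by
    rw [show -1 - x = -(1 + x) by ring, Real.log_neg_eq_log]
  simp only [hN, e1, e2, add_sub_cancel_left]
  norm_num
  ring

lemma abs_slope_le_of_lipschitzOnWith {K : ℝ → ℝ} {L : NNReal}
    (hK : LipschitzOnWith L K (Icc (-1) 1)) {x t : ℝ} (hx : x ∈ Icc (-1 : ℝ) 1)
    (ht : t ∈ Icc (-1 : ℝ) 1) : |(K t - K x) / (t - x)| ≤ L := by
  rw [abs_div]
  refine div_le_of_le_mul₀ (abs_nonneg _) L.2 ?_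
  simpa [Real.dist_eq] using hK.dist_le_mul t ht x hx

lemma tendsto_principalValue_of_lipschitz {K : ℝ → ℝ} {L : NNReal}
    (hK : LipschitzOnWith L K (Icc (-1) 1)) {x : ℝ} (hx : x ∈ Ioo (-1 : ℝ) 1) :
    Tendsto (fun ε : ℝ => ∫ t in (Ioo (-1 : ℝ) 1 \ Ioo (x - ε) (x + ε)),
      K t / Real.sqrt (1 - t ^ 2) / (t - x)) (nhdsWithin 0 (Ioi 0))
      (nhds (∫ θ in Ioo 0 Real.pi, (K (Real.cos θ) - K x) / (Real.cos θ - x))) := by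
  have hKm : AEStronglyMeasurable (fun t => (K t - K x) / (t - x))
      (volume.restrict (Ioo (-1) 1)) := by
    have h1 : AEMeasurable K (volume.restrict (Ioo (-1) 1)) :=
      (hK.continuousOn.mono Ioo_subset_Icc_self).aemeasurable measurableSet_Ioo
    exact ((h1.sub_const _).div (by fun_prop)).aestronglyMeasurable
  have hint : IntegrableOn (fun t => (Real.sqrt (1 - t ^ 2))⁻¹ * ((K t - K x) / (t - x)))
      (Ioo (-1) 1) :=
    integrableOn_inv_sqrt_mul_of_bound subset_rfl measurableSet_Ioo hKm fun t ht =>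
      abs_slope_le_of_lipschitzOnWith hK (Ioo_subset_Icc_self hx) (Ioo_subset_Icc_self ht)
  have hms : ∀ ε, MeasurableSet (Ioo (-1 : ℝ) 1 \ Ioo (x - ε) (x + ε)) := fun ε =>
    measurableSet_Ioo.diff measurableSet_Ioo
  have hlim1 : Tendsto (fun ε : ℝ => ∫ t in (Ioo (-1 : ℝ) 1 \ Ioo (x - ε) (x + ε)),
      (Real.sqrt (1 - t ^ 2))⁻¹ * ((K t - K x) / (t - x))) (nhdsWithin 0 (Ioi 0))
      (nhds (∫ θ in Ioo 0 Real.pi, (K (Real.cos θ) - K x) / (Real.cos θ - x))) := by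
    rw [← setIntegral_inv_sqrt_smul_eq_cos fun t => (K t - K x) / (t - x)]
    simp only [smul_eq_mul]
    have : ∀ ε, ∫ t in (Ioo (-1 : ℝ) 1 \ Ioo (x - ε) (x + ε)),
        (Real.sqrt (1 - t ^ 2))⁻¹ * ((K t - K x) / (t - x)) =
        ∫ t in Ioo (-1) 1, ((Ioo (x - ε) (x + ε))ᶜ).indicator
          (fun t => (Real.sqrt (1 - t ^ 2))⁻¹ * ((K t - K x) / (t - x))) t := fun ε => by
      rw [setIntegral_indicator measurableSet_Ioo.compl, sdiff_eq]
    simp only [this]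
    refine tendsto_integral_filter_of_dominated_convergence
      (fun t => ‖(Real.sqrt (1 - t ^ 2))⁻¹ * ((K t - K x) / (t - x))‖) ?_ ?_ hint.norm ?_
    · exact Eventually.of_forall fun ε =>
        hint.aestronglyMeasurable.indicator measurableSet_Ioo.compl
    · exact Eventually.of_forall fun ε => ae_of_all _ fun t => norm_indicator_le_norm_self _ _
    · filter_upwards [(ae_restrict_of_ae (Measure.ae_ne volume x) :
        ∀ᵐ t ∂volume.restrict (Ioo (-1) 1), t ≠ x)] with t ht
      refine tendsto_const_nhds.congr' ?_
      have hpos : 0 < |t - x| := abs_pos.2 (sub_ne_zero.2 ht)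
      filter_upwards [Ioo_mem_nhdsGT hpos] with ε hε
      rw [indicator_of_mem]
      rintro ⟨h1, h2⟩
      exact (abs_lt.2 ⟨by linarith, by linarith⟩ : |t - x| < ε).not_gt hε.2
  have hlim2 := hlim1.add ((tendsto_principalValue_inv_sqrt hx).const_mul (K x))
  rw [mul_zero, add_zero] at hlim2
  refine hlim2.congr' ?_
  filter_upwards [self_mem_nhdsWithin] with ε hε
  rw [← integral_const_mul, ← integral_add (hint.mono_set sdiff_subset)
    ((integrableOn_inv_sqrt_div_sub hε sdiff_subset (fun t ht => ht.2) (hms ε)).const_mul _)]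
  refine setIntegral_congr_fun (hms ε) fun t _ => ?_
  ring

lemma tendsto_cauchy_diff_of_lipschitz {K : ℝ → ℝ} {L : NNReal}
    (hK : LipschitzOnWith L K (Icc (-1) 1)) {x : ℝ} (hx : x ∈ Ioo (-1 : ℝ) 1) :
    Tendsto (fun z : ℂ => ∫ θ in Ioo 0 Real.pi,
      ((K (Real.cos θ) - K z.re : ℝ) : ℂ) / (z - (Real.cos θ : ℂ)))
      (nhds (x : ℂ))
      (nhds (-(∫ θ in Ioo 0 Real.pi, (K (Real.cos θ) - K x) / (Real.cos θ - x) : ℝ) : ℂ)) := by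
  have hcos : ∀ θ, Real.cos θ ∈ Icc (-1 : ℝ) 1 := Real.cos_mem_Icc
  have hKc : Continuous fun θ => K (Real.cos θ) :=
    hK.continuousOn.comp_continuous Real.continuous_cos hcos
  rw [← integral_complex_ofReal, ← integral_neg]
  have hre : ∀ᶠ z : ℂ in nhds (x : ℂ), z.re ∈ Ioo (-1 : ℝ) 1 :=
    Complex.continuous_re.continuousAt.eventually (isOpen_Ioo.mem_nhds hx)
  refine tendsto_integral_filter_of_dominated_convergence (fun _ => (L : ℝ)) ?_ ?_
    (integrableOn_const (by simp)) ?_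
  · refine Eventually.of_forall fun z => Measurable.aestronglyMeasurable ?_
    exact (Complex.measurable_ofReal.comp (hKc.measurable.sub_const _)).div (by fun_prop)
  · filter_upwards [hre] with z hz
    refine ae_of_all _ fun θ => ?_
    rw [norm_div, Complex.norm_real, Real.norm_eq_abs]
    refine div_le_of_le_mul₀ (norm_nonneg _) L.2 ?_
    have h1 := hK.dist_le_mul _ (hcos θ) _ (Ioo_subset_Icc_self hz)
    rw [Real.dist_eq, Real.dist_eq] at h1
    refine h1.trans (mul_le_mul_of_nonneg_left ?_ L.2)
    have h2 := Complex.abs_re_le_norm (z - (Real.cos θ : ℂ))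
    rwa [Complex.sub_re, Complex.ofReal_re, abs_sub_comm] at h2
  · have hae : ∀ᵐ θ ∂volume.restrict (Ioo 0 Real.pi), θ ≠ Real.arccos x :=
      ae_restrict_of_ae (Measure.ae_ne volume _)
    filter_upwards [hae, ae_restrict_mem measurableSet_Ioo] with θ hθ hθI
    have hne : Real.cos θ ≠ x := fun h => hθ (by
      rw [← h, Real.arccos_cos hθI.1.le hθI.2.le])
    have hKx : ContinuousAt K x := hK.continuousOn.continuousAt (Icc_mem_nhds hx.1 hx.2)
    have hne' : (x : ℂ) - (Real.cos θ : ℂ) ≠ 0 := by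
      rw [sub_ne_zero]; exact_mod_cast hne.symm
    have hc : ContinuousAt (fun z : ℂ => ((K (Real.cos θ) - K z.re : ℝ) : ℂ) /
        (z - (Real.cos θ : ℂ))) x := by
      refine ContinuousAt.div ?_ (by fun_prop) hne'
      refine Complex.continuous_ofReal.continuousAt.comp (continuousAt_const.sub ?_)
      exact ContinuousAt.comp (g := K) (by simpa using hKx) Complex.continuous_re.continuousAt
    convert hc.tendsto using 2
    rw [Complex.ofReal_div, Complex.ofReal_sub (Real.cos θ), Complex.ofReal_re, ← div_neg,
      neg_sub]

/-- The branch of `√(z² - 1)` given by principal logarithms off `(-∞, 1]`. -/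
noncomputable def sqrtBranch (z : ℂ) : ℂ :=
  Complex.exp ((Complex.log (z - 1) + Complex.log (z + 1)) / 2)

lemma sqrtBranch_sq {z : ℂ} (h1 : z - 1 ≠ 0) (h2 : z + 1 ≠ 0) : sqrtBranch z ^ 2 = z ^ 2 - 1 := by
  rw [sqrtBranch, ← Complex.exp_nat_mul]
  push_cast
  rw [mul_div_cancel₀ _ (two_ne_zero), Complex.exp_add, Complex.exp_log h1, Complex.exp_log h2]
  ring

lemma eq_sqrtBranch {sq : ℂ → ℂ}
    (hsq_an : AnalyticOnNhd ℂ sq ({z : ℂ | z.im = 0 ∧ |z.re| ≤ 1}ᶜ))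
    (hsq_sq : ∀ z ∈ ({z : ℂ | z.im = 0 ∧ |z.re| ≤ 1}ᶜ : Set ℂ), sq z ^ 2 = z ^ 2 - 1)
    (hsq_pos : ∀ x : ℝ, 1 < x → sq (x : ℂ) = ((Real.sqrt (x ^ 2 - 1) : ℝ) : ℂ))
    {z : ℂ} (hz : z - 1 ∈ Complex.slitPlane) : sq z = sqrtBranch z := by
  have hplus : ∀ u ∈ Complex.slitPlane, u + 1 + 1 ∈ Complex.slitPlane := by
    rintro u (hu | hu)
    · left; simp only [Complex.add_re, Complex.one_re]; linarith
    · right; simpa using hu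
  have hdom : ∀ u ∈ Complex.slitPlane, u + 1 ∈ ({z : ℂ | z.im = 0 ∧ |z.re| ≤ 1}ᶜ : Set ℂ) := by
    rintro u hu ⟨h1, h2⟩
    simp only [Complex.add_im, Complex.one_im, add_zero, Complex.add_re, Complex.one_re] at h1 h2
    rcases hu with hu | hu
    · linarith [(abs_le.1 h2).2]
    · exact hu h1
  have hpre : IsPreconnected Complex.slitPlane :=
    (Complex.starConvex_one_slitPlane.isPathConnected
      Complex.one_mem_slitPlane).isConnected.isPreconnected
  have key : EqOn (fun u => sq (u + 1)) (fun u => sqrtBranch (u + 1)) Complex.slitPlane := by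
    refine hpre.eq_of_sq_eq ?_ ?_ ?_ (fun _ => Complex.exp_ne_zero _)
      Complex.one_mem_slitPlane ?_
    · exact hsq_an.continuousOn.comp (by fun_prop) hdom
    · unfold sqrtBranch
      refine ContinuousOn.cexp (ContinuousOn.div_const (ContinuousOn.add ?_ ?_) _)
      · exact ContinuousOn.clog (by fun_prop) fun u hu => by simpa using hu
      · exact ContinuousOn.clog (by fun_prop) hplus
    · intro u hu
      simp only [Pi.pow_apply]
      rw [hsq_sq _ (hdom u hu), sqrtBranch_sq]
      · simpa using Complex.slitPlane_ne_zero hu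
      · exact Complex.slitPlane_ne_zero (hplus u hu)
    · have h2 := hsq_pos 2 (by norm_num)
      norm_num at h2
      norm_num [sqrtBranch]
      rw [h2, Real.sqrt_eq_rpow, Real.rpow_def_of_pos (by norm_num)]
      push_cast
      congr 1
      rw [Complex.ofReal_log (by norm_num)]
      push_cast
      ring
  simpa using key hz

lemma sub_one_mem_slitPlane {z : ℂ} (hz : z.im ≠ 0) : z - 1 ∈ Complex.slitPlane :=
  Or.inr (by simpa using hz)

lemma add_one_mem_slitPlane {z : ℂ} (hz : z.im ≠ 0) : z + 1 ∈ Complex.slitPlane :=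
  Or.inr (by simpa using hz)

lemma sqrtBranch_conj {z : ℂ} (hz : z.im ≠ 0) :
    sqrtBranch ((starRingEnd ℂ) z) = (starRingEnd ℂ) (sqrtBranch z) := by
  rw [sqrtBranch, sqrtBranch, ← Complex.exp_conj, map_div₀, map_add,
    ← Complex.log_conj _ (Complex.slitPlane_arg_ne_pi (sub_one_mem_slitPlane hz)),
    ← Complex.log_conj _ (Complex.slitPlane_arg_ne_pi (add_one_mem_slitPlane hz))]
  simp [map_ofNat (starRingEnd ℂ) 2]

lemma sqrtBranch_sq_of_im_pos {z : ℂ} (hz : 0 < z.im) : sqrtBranch z ^ 2 = z ^ 2 - 1 :=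
  sqrtBranch_sq (Complex.slitPlane_ne_zero (sub_one_mem_slitPlane hz.ne'))
    (Complex.slitPlane_ne_zero (add_one_mem_slitPlane hz.ne'))

lemma sqrtBranch_im_pos {z : ℂ} (hz : 0 < z.im) : 0 < (sqrtBranch z).im := by
  have arg_mem : ∀ u : ℂ, 0 < u.im → 0 < u.arg ∧ u.arg < Real.pi := fun u hu => by
    refine ⟨lt_of_le_of_ne (Complex.arg_nonneg_iff.2 hu.le) fun h => ?_,
      lt_of_le_of_ne (Complex.arg_le_pi u) fun h => ?_⟩
    · exact hu.ne' (Complex.arg_eq_zero_iff.1 h.symm).2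
    · exact hu.ne' (Complex.arg_eq_pi_iff.1 h).2
  obtain ⟨h1, h2⟩ := arg_mem (z - 1) (by simpa using hz)
  obtain ⟨h3, h4⟩ := arg_mem (z + 1) (by simpa using hz)
  rw [sqrtBranch, Complex.exp_im]
  have him : ((Complex.log (z - 1) + Complex.log (z + 1)) / 2).im =
      ((z - 1).arg + (z + 1).arg) / 2 := by
    rw [Complex.div_ofNat_im, Complex.add_im, Complex.log_im, Complex.log_im]
  rw [him]
  exact mul_pos (Real.exp_pos _) (Real.sin_pos_of_pos_of_lt_pi (by linarith) (by linarith))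

lemma sub_mul_add_sqrtBranch {z : ℂ} (hz : 0 < z.im) :
    (z - sqrtBranch z) * (z + sqrtBranch z) = 1 := by
  linear_combination -sqrtBranch_sq_of_im_pos hz

lemma norm_sub_sqrtBranch_lt_one {z : ℂ} (hz : 0 < z.im) : ‖z - sqrtBranch z‖ < 1 := by
  have h1 := sub_mul_add_sqrtBranch hz
  have hs := sqrtBranch_im_pos hz
  set s := sqrtBranch z
  have hlt : Complex.normSq (z - s) < 1 := by
    have hne : z - s ≠ 0 := left_ne_zero_of_mul_eq_one h1
    have hpos := Complex.normSq_pos.2 hne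
    have h2 : z + s = (z - s)⁻¹ := eq_inv_of_mul_eq_one_right h1
    have h3 := congrArg Complex.im h2
    rw [Complex.inv_im, eq_div_iff hpos.ne'] at h3
    simp only [Complex.add_im, Complex.sub_im] at h3
    nlinarith
  rw [Complex.normSq_eq_norm_sq] at hlt
  nlinarith [norm_nonneg (z - s)]

lemma tendsto_sqrtBranch {x : ℝ} (hx : x ∈ Ioo (-1 : ℝ) 1) :
    Tendsto sqrtBranch (nhdsWithin (x : ℂ) {z : ℂ | 0 < z.im})
      (nhds (Complex.I * (Real.sqrt (1 - x ^ 2) : ℂ))) := by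
  have hx2 : 0 < 1 - x ^ 2 := by nlinarith [hx.1, hx.2]
  have heq : ∀ z : ℂ, 0 < z.im → Complex.I * (1 - z ^ 2) ^ (1 / 2 : ℂ) = sqrtBranch z := by
    intro z hz
    have hs := sqrtBranch_im_pos hz
    have h2 : 1 - z ^ 2 = (-Complex.I * sqrtBranch z) ^ 2 := by
      rw [mul_pow, sqrtBranch_sq_of_im_pos hz, neg_sq, Complex.I_sq]; ring
    have h3 : ((-Complex.I * sqrtBranch z) ^ 2) ^ (1 / 2 : ℂ) = -Complex.I * sqrtBranch z := by
      have hre : 0 < (-Complex.I * sqrtBranch z).re := by simpa using hs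
      have harg := Complex.abs_arg_lt_pi_div_two_iff.2 (Or.inl hre)
      rw [abs_lt] at harg
      have := Complex.pow_cpow_nat_inv (n := 2) two_ne_zero (x := -Complex.I * sqrtBranch z)
        (by push_cast; linarith) (by push_cast; linarith)
      simpa using this
    rw [h2, h3, ← mul_assoc]
    simp
  have hc : ContinuousAt (fun z : ℂ => Complex.I * (1 - z ^ 2) ^ (1 / 2 : ℂ)) x := by
    refine ContinuousAt.mul (by fun_prop) (ContinuousAt.cpow (by fun_prop) (by fun_prop) ?_)
    left
    exact_mod_cast hx2
  have hval : Complex.I * (1 - (x : ℂ) ^ 2) ^ (1 / 2 : ℂ) =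
      Complex.I * (Real.sqrt (1 - x ^ 2) : ℂ) := by
    rw [Real.sqrt_eq_rpow, Complex.ofReal_cpow hx2.le]
    push_cast
    rfl
  rw [← hval]
  refine (hc.tendsto.mono_left nhdsWithin_le_nhds).congr' ?_
  filter_upwards [self_mem_nhdsWithin] with z hz
  exact heq z hz

lemma sqrtBranch_div_eq_poisson {z : ℂ} (hz : 0 < z.im) (θ : ℝ) :
    sqrtBranch z / (z - (Real.cos θ : ℂ)) = (1 - (z - sqrtBranch z) ^ 2) /
      (1 - 2 * (z - sqrtBranch z) * (Real.cos θ : ℂ) + (z - sqrtBranch z) ^ 2) := by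
  have h1 := sqrtBranch_sq_of_im_pos hz
  have hne : z - (Real.cos θ : ℂ) ≠ 0 := fun h => by
    have := congrArg Complex.im h
    rw [Complex.sub_im, Complex.ofReal_im] at this
    simp only [Complex.zero_im] at this
    linarith
  rw [div_eq_div_iff hne (poissonDenom_ne_zero (norm_sub_sqrtBranch_lt_one hz) θ)]
  linear_combination (sqrtBranch z - z + (Real.cos θ : ℂ)) * h1

lemma setIntegral_cauchy_eq {K : ℝ → ℝ} (hK : ContinuousOn K (Icc (-1) 1)) (α β : ℝ) {z : ℂ}
    (hz : 0 < z.im) :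
    sqrtBranch z * ∫ θ in Ioo 0 Real.pi, ((K (Real.cos θ) + α * Real.log (1 - Real.cos θ) +
        β * Real.log (1 + Real.cos θ) : ℝ) : ℂ) / (z - (Real.cos θ : ℂ)) =
      sqrtBranch z * (∫ θ in Ioo 0 Real.pi,
        ((K (Real.cos θ) - K z.re : ℝ) : ℂ) / (z - (Real.cos θ : ℂ))) +
      (K z.re * Real.pi +
        α * (2 * Real.pi * Complex.log (1 - (z - sqrtBranch z)) - Real.pi * Real.log 2) +
        β * (2 * Real.pi * Complex.log (1 + (z - sqrtBranch z)) - Real.pi * Real.log 2)) := by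
  have hζ := norm_sub_sqrtBranch_lt_one hz
  have hP := continuous_poisson hζ
  have hKc : Continuous fun θ => K (Real.cos θ) :=
    hK.comp_continuous Real.continuous_cos Real.cos_mem_Icc
  rw [← integral_log_one_sub_cos_mul_poisson hζ, ← integral_log_one_add_cos_mul_poisson hζ,
    ← integral_poisson hζ]
  simp only [← integral_Ioc_eq_integral_Ioo, ← intervalIntegral.integral_of_le Real.pi_pos.le]
  simp only [← intervalIntegral.integral_const_mul]
  have hi1 : IntervalIntegrable (fun θ : ℝ => sqrtBranch z *
      (((K (Real.cos θ) - K z.re : ℝ) : ℂ) / (z - (Real.cos θ : ℂ)))) volume 0 Real.pi := by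
    have : (fun θ : ℝ => sqrtBranch z *
      (((K (Real.cos θ) - K z.re : ℝ) : ℂ) / (z - (Real.cos θ : ℂ)))) = fun θ : ℝ =>
      ((K (Real.cos θ) - K z.re : ℝ) : ℂ) * ((1 - (z - sqrtBranch z) ^ 2) /
      (1 - 2 * (z - sqrtBranch z) * (Real.cos θ : ℂ) + (z - sqrtBranch z) ^ 2)) := by
      funext θ
      rw [← sqrtBranch_div_eq_poisson hz]
      ring
    rw [this]
    refine Continuous.intervalIntegrable (Continuous.mul ?_ hP) _ _
    exact Complex.continuous_ofReal.comp (hKc.sub continuous_const)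
  have hi2 := (hP.intervalIntegrable (μ := volume) 0 Real.pi).const_mul (K z.re : ℂ)
  have hi3 := (IntervalIntegrable.mul_continuousOn
      (f := fun θ : ℝ => (Real.log (1 - Real.cos θ) : ℂ))
      ⟨(intervalIntegrable_log_one_sub_cos 0 Real.pi).1.ofReal,
        (intervalIntegrable_log_one_sub_cos 0 Real.pi).2.ofReal⟩ hP.continuousOn).const_mul (α : ℂ)
  have hi4 := (IntervalIntegrable.mul_continuousOn
      (f := fun θ : ℝ => (Real.log (1 + Real.cos θ) : ℂ))
      ⟨(intervalIntegrable_log_one_add_cos 0 Real.pi).1.ofReal,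
        (intervalIntegrable_log_one_add_cos 0 Real.pi).2.ofReal⟩ hP.continuousOn).const_mul (β : ℂ)
  rw [← intervalIntegral.integral_add hi2 hi3, ← intervalIntegral.integral_add (hi2.add hi3) hi4,
    ← intervalIntegral.integral_add hi1 ((hi2.add hi3).add hi4)]
  refine intervalIntegral.integral_congr fun θ _ => ?_
  simp only [← sqrtBranch_div_eq_poisson hz]
  push_cast
  ring

lemma log_one_sub_exp_boundary {x : ℝ} (hx : x ∈ Ioo (-1 : ℝ) 1) :
    Complex.log (1 - (x - Complex.I * (Real.sqrt (1 - x ^ 2) : ℂ))) =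
      ((Real.log 2 + Real.log (1 - x)) / 2 : ℝ) +
        ((Real.pi - Real.arccos x) / 2 : ℝ) * Complex.I := by
  have h0 := Real.arccos_pos.2 hx.2
  have h1 := Real.arccos_lt_pi.2 hx.1
  have hs0 : 0 < Real.sin (Real.arccos x / 2) :=
    Real.sin_pos_of_pos_of_lt_pi (by linarith) (by linarith)
  have hxc : x = 1 - 2 * Real.sin (Real.arccos x / 2) ^ 2 := by
    rw [Real.sin_sq_eq_half_sub, mul_div_cancel₀ _ two_ne_zero, Real.cos_arccos hx.1.le hx.2.le]
    ring
  have hsc : Real.sqrt (1 - x ^ 2) =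
      2 * Real.sin (Real.arccos x / 2) * Real.cos (Real.arccos x / 2) := by
    rw [← Real.sin_two_mul, mul_div_cancel₀ _ two_ne_zero, Real.sin_arccos]
  have hkey : 1 - (x - Complex.I * (Real.sqrt (1 - x ^ 2) : ℂ)) =
      ((2 * Real.sin (Real.arccos x / 2) : ℝ) : ℂ) *
        Complex.exp (((Real.pi - Real.arccos x) / 2 : ℝ) * Complex.I) := by
    rw [Complex.exp_mul_I, ← Complex.ofReal_cos, ← Complex.ofReal_sin, hsc, sub_div,
      Real.cos_pi_div_two_sub, Real.sin_pi_div_two_sub]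
    nth_rewrite 1 [hxc]
    push_cast
    ring
  rw [hkey, Complex.log_ofReal_mul (by positivity) (Complex.exp_ne_zero _), Complex.log_exp]
  · congr 2
    rw [show 1 - x = 2 * Real.sin (Real.arccos x / 2) ^ 2 by linarith,
      Real.log_mul two_ne_zero hs0.ne', Real.log_mul two_ne_zero (by positivity), Real.log_pow]
    push_cast
    ring
  · rw [Complex.im_ofReal_mul, Complex.I_im, mul_one]
    linarith
  · rw [Complex.im_ofReal_mul, Complex.I_im, mul_one]
    linarith

lemma log_one_add_exp_boundary {x : ℝ} (hx : x ∈ Ioo (-1 : ℝ) 1) :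
    Complex.log (1 + (x - Complex.I * (Real.sqrt (1 - x ^ 2) : ℂ))) =
      ((Real.log 2 + Real.log (1 + x)) / 2 : ℝ) - (Real.arccos x / 2 : ℝ) * Complex.I := by
  have hsl : 1 + (x + Complex.I * (Real.sqrt (1 - x ^ 2) : ℂ)) ∈ Complex.slitPlane := by
    left
    simp
    linarith [hx.1]
  have h := log_one_sub_exp_boundary (x := -x) ⟨by linarith [hx.2], by linarith [hx.1]⟩
  rw [Real.arccos_neg] at h
  have e : 1 + (x - Complex.I * (Real.sqrt (1 - x ^ 2) : ℂ)) = (starRingEnd ℂ)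
      (1 - (((-x : ℝ) : ℂ) - Complex.I * (Real.sqrt (1 - (-x) ^ 2) : ℂ))) := by
    simp
    ring
  rw [e, Complex.log_conj _ (Complex.slitPlane_arg_ne_pi ?_), h]
  · rw [map_add, map_mul, Complex.conj_ofReal, Complex.conj_ofReal, Complex.conj_I,
      show Real.pi - (Real.pi - Real.arccos x) = Real.arccos x by ring, sub_neg_eq_add]
    ring
  · convert hsl using 1
    simp
    ring

lemma tendsto_log_boundary {x : ℝ} (hx : x ∈ Ioo (-1 : ℝ) 1) :
    Tendsto (fun z => Complex.log (1 - (z - sqrtBranch z)))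
      (nhdsWithin (x : ℂ) {z : ℂ | 0 < z.im})
      (nhds (((Real.log 2 + Real.log (1 - x)) / 2 : ℝ) +
        ((Real.pi - Real.arccos x) / 2 : ℝ) * Complex.I)) ∧
    Tendsto (fun z => Complex.log (1 + (z - sqrtBranch z)))
      (nhdsWithin (x : ℂ) {z : ℂ | 0 < z.im})
      (nhds (((Real.log 2 + Real.log (1 + x)) / 2 : ℝ) -
        (Real.arccos x / 2 : ℝ) * Complex.I)) := by
  have hid : Tendsto (fun z : ℂ => z) (nhdsWithin (x : ℂ) {z : ℂ | 0 < z.im}) (nhds (x : ℂ)) :=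
    tendsto_id.mono_left nhdsWithin_le_nhds
  have hd := hid.sub (tendsto_sqrtBranch hx)
  rw [← log_one_sub_exp_boundary hx, ← log_one_add_exp_boundary hx]
  constructor
  · refine (tendsto_const_nhds.sub hd).clog (Or.inl ?_)
    simp
    linarith [hx.2]
  · refine (tendsto_const_nhds.add hd).clog (Or.inl ?_)
    simp
    linarith [hx.1]

/-- Boundary values of the Szegő exponent from the upper half plane. -/
lemma tendsto_szego_exponent {K : ℝ → ℝ} {L : NNReal}
    (hK : LipschitzOnWith L K (Icc (-1) 1)) (α β : ℝ) {x c : ℝ} (hx : x ∈ Ioo (-1 : ℝ) 1)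
    (hc : Tendsto (fun ε : ℝ => ∫ t in (Ioo (-1 : ℝ) 1 \ Ioo (x - ε) (x + ε)),
      K t / Real.sqrt (1 - t ^ 2) / (t - x)) (nhdsWithin 0 (Ioi 0))
      (nhds (2 * Real.pi * c / Real.sqrt (1 - x ^ 2)))) :
    Tendsto (fun z : ℂ => sqrtBranch z / (2 * (Real.pi : ℂ)) * ∫ θ in Ioo 0 Real.pi,
        ((K (Real.cos θ) + α * Real.log (1 - Real.cos θ) +
        β * Real.log (1 + Real.cos θ) : ℝ) : ℂ) / (z - (Real.cos θ : ℂ)))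
      (nhdsWithin (x : ℂ) {z : ℂ | 0 < z.im})
      (nhds (((K x + α * Real.log (1 - x) + β * Real.log (1 + x)) / 2 : ℝ) + Complex.I *
        ((Real.pi * α / 2 - (α + β) / 2 * Real.arccos x - c : ℝ) : ℂ))) := by
  have hx2 : 0 < 1 - x ^ 2 := by nlinarith [hx.1, hx.2]
  have hs := Real.sqrt_pos.2 hx2
  have hI := tendsto_nhds_unique hc (tendsto_principalValue_of_lipschitz hK hx)
  have h1 := (tendsto_cauchy_diff_of_lipschitz hK hx).mono_left
    (nhdsWithin_le_nhds (s := {z : ℂ | 0 < z.im}))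
  rw [← hI] at h1
  have hKx : ContinuousAt K x := hK.continuousOn.continuousAt (Icc_mem_nhds hx.1 hx.2)
  have h2 : Tendsto (fun z : ℂ => (K z.re : ℂ)) (nhdsWithin (x : ℂ) {z : ℂ | 0 < z.im})
      (nhds (K x : ℂ)) := by
    have : ContinuousAt (fun z : ℂ => (K z.re : ℂ)) x :=
      Complex.continuous_ofReal.continuousAt.comp
        (ContinuousAt.comp (g := K) (by simpa using hKx) Complex.continuous_re.continuousAt)
    exact this.tendsto.mono_left nhdsWithin_le_nhds
  obtain ⟨h3, h4⟩ := tendsto_log_boundary hx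
  have h5 := ((((tendsto_sqrtBranch hx).mul h1).add (((h2.mul_const (Real.pi : ℂ)).add
    (((h3.const_mul (2 * Real.pi : ℂ)).sub_const (Real.pi * Real.log 2 : ℂ)).const_mul
      (α : ℂ))).add
    (((h4.const_mul (2 * Real.pi : ℂ)).sub_const (Real.pi * Real.log 2 : ℂ)).const_mul
      (β : ℂ)))).div_const (2 * (Real.pi : ℂ)))
  have hpi : (Real.pi : ℂ) ≠ 0 := by exact_mod_cast Real.pi_ne_zero
  have hsC : (Real.sqrt (1 - x ^ 2) : ℂ) ≠ 0 := by exact_mod_cast hs.ne'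
  convert h5.congr' ?_ using 2
  · push_cast
    field_simp
    ring
  · filter_upwards [self_mem_nhdsWithin] with z hz
    rw [← setIntegral_cauchy_eq hK.continuousOn α β hz]
    ring

lemma tendsto_conj_lower {F : ℂ → ℂ} {x : ℝ} {v : ℂ}
    (hF : ∀ z : ℂ, z.im ≠ 0 → F ((starRingEnd ℂ) z) = (starRingEnd ℂ) (F z))
    (hv : Tendsto F (nhdsWithin (x : ℂ) {z : ℂ | 0 < z.im}) (nhds v)) :
    Tendsto F (nhdsWithin (x : ℂ) {z : ℂ | z.im < 0}) (nhds ((starRingEnd ℂ) v)) := by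
  have hc : Tendsto (starRingEnd ℂ) (nhdsWithin (x : ℂ) {z : ℂ | z.im < 0})
      (nhdsWithin (x : ℂ) {z : ℂ | 0 < z.im}) := by
    refine tendsto_nhdsWithin_iff.2 ⟨?_, ?_⟩
    · have := (Complex.continuous_conj.tendsto (x : ℂ)).mono_left
        (nhdsWithin_le_nhds (s := {z : ℂ | z.im < 0}))
      rwa [Complex.conj_ofReal] at this
    · filter_upwards [self_mem_nhdsWithin] with z hz
      simpa using hz
  refine ((Complex.continuous_conj.tendsto v).comp (hv.comp hc)).congr' ?_
  filter_upwards [self_mem_nhdsWithin] with z hz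
  simp only [Function.comp_apply]
  rw [hF z (ne_of_lt hz), Complex.conj_conj]

theorem stmt15
    (α β : ℝ) (hα : -1 < α) (hβ : -1 < β)
    (h : ℝ → ℝ)
    (h_an : AnalyticOnNhd ℝ h (Icc (-1) 1))
    (h_pos : ∀ x ∈ Icc (-1 : ℝ) 1, 0 < h x)
    -- the analytic Jacobi-type weight w(x) = h(x)(1-x)^α(1+x)^β
    (w : ℝ → ℝ)
    (hw : ∀ x : ℝ, w x = h x * (1 - x) ^ α * (1 + x) ^ β)
    -- the branch of √(z²-1), analytic off [-1,1] and positive on (1,∞)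
    (sq : ℂ → ℂ)
    (hsq_an : AnalyticOnNhd ℂ sq ({z : ℂ | z.im = 0 ∧ |z.re| ≤ 1}ᶜ))
    (hsq_sq : ∀ z ∈ ({z : ℂ | z.im = 0 ∧ |z.re| ≤ 1}ᶜ : Set ℂ), sq z ^ 2 = z ^ 2 - 1)
    (hsq_pos : ∀ x : ℝ, 1 < x → sq (x : ℂ) = ((Real.sqrt (x ^ 2 - 1) : ℝ) : ℂ))
    -- the Szegő function of w
    (D : ℂ → ℂ)
    (hD : ∀ z : ℂ, D z =
      Complex.exp (sq z / (2 * (Real.pi : ℂ)) *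
        ∫ t in (-1 : ℝ)..1,
          ((Real.log (w t) / Real.sqrt (1 - t ^ 2) : ℝ) : ℂ) / (z - (t : ℂ))))
    -- ħ, defined by the principal value integral
    (hbar : ℝ → ℝ)
    (hhbar : ∀ x ∈ Ioo (-1 : ℝ) 1,
      Tendsto (fun ε : ℝ =>
          ∫ t in (Ioo (-1 : ℝ) 1 \ Ioo (x - ε) (x + ε)),
            Real.log (h t) / Real.sqrt (1 - t ^ 2) / (t - x))
        (nhdsWithin 0 (Ioi 0)) (nhds (2 * Real.pi * hbar x / Real.sqrt (1 - x ^ 2)))) :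
    -- boundary behavior: D(z) → √(w(x))·e^{±iΦ(x)} as z → x from the upper/lower half plane
    ∀ x ∈ Ioo (-1 : ℝ) 1,
      Tendsto D (nhdsWithin (x : ℂ) {z : ℂ | 0 < z.im})
        (nhds (((Real.sqrt (w x) : ℝ) : ℂ) *
          Complex.exp (Complex.I *
            ((Real.pi * α / 2 - (α + β) / 2 * Real.arccos x - hbar x : ℝ) : ℂ)))) ∧
      Tendsto D (nhdsWithin (x : ℂ) {z : ℂ | z.im < 0})
        (nhds (((Real.sqrt (w x) : ℝ) : ℂ) *
          Complex.exp (-Complex.I *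
            ((Real.pi * α / 2 - (α + β) / 2 * Real.arccos x - hbar x : ℝ) : ℂ)))) := by
  intro x hx
  have hne : ∀ t ∈ Icc (-1 : ℝ) 1, h t ≠ 0 := fun t ht => (h_pos t ht).ne'
  obtain ⟨L, hL⟩ : ∃ L, LipschitzOnWith L (fun t => Real.log (h t)) (Icc (-1 : ℝ) 1) :=
    ContDiffOn.exists_lipschitzOnWith
      (((h_an.contDiffOn (n := 1) (uniqueDiffOn_Icc (by norm_num)))).log hne) one_ne_zero
      (convex_Icc _ _) isCompact_Icc
  have hwpos : ∀ t ∈ Ioo (-1 : ℝ) 1, 0 < w t := fun t ht => by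
    rw [hw]
    exact mul_pos (mul_pos (h_pos t (Ioo_subset_Icc_self ht))
      (Real.rpow_pos_of_pos (by linarith [ht.2]) _)) (Real.rpow_pos_of_pos (by linarith [ht.1]) _)
  have hlog : ∀ t ∈ Ioo (-1 : ℝ) 1,
      Real.log (w t) = Real.log (h t) + α * Real.log (1 - t) + β * Real.log (1 + t) := by
    intro t ht
    have h1 : 0 < 1 - t := by linarith [ht.2]
    have h2 : 0 < 1 + t := by linarith [ht.1]
    have h3 := h_pos t (Ioo_subset_Icc_self ht)
    rw [hw, Real.log_mul (by positivity) (by positivity), Real.log_mul h3.ne' (by positivity),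
      Real.log_rpow h1, Real.log_rpow h2]
  have hint : ∀ z : ℂ, (∫ t in (-1 : ℝ)..1,
      ((Real.log (w t) / Real.sqrt (1 - t ^ 2) : ℝ) : ℂ) / (z - (t : ℂ))) =
      ∫ θ in Ioo 0 Real.pi, ((Real.log (h (Real.cos θ)) + α * Real.log (1 - Real.cos θ) +
        β * Real.log (1 + Real.cos θ) : ℝ) : ℂ) / (z - (Real.cos θ : ℂ)) := by
    intro z
    rw [intervalIntegral.integral_of_le (by norm_num), integral_Ioc_eq_integral_Ioo,
      ← setIntegral_inv_sqrt_smul_eq_cos (fun t => ((Real.log (h t) + α * Real.log (1 - t) +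
        β * Real.log (1 + t) : ℝ) : ℂ) / (z - (t : ℂ)))]
    refine setIntegral_congr_fun measurableSet_Ioo fun t ht => ?_
    simp only [hlog t ht, Complex.real_smul, Complex.ofReal_div, Complex.ofReal_inv]
    ring
  have hDz : ∀ z : ℂ, z.im ≠ 0 → D z = Complex.exp (sqrtBranch z / (2 * (Real.pi : ℂ)) *
      ∫ θ in Ioo 0 Real.pi, ((Real.log (h (Real.cos θ)) + α * Real.log (1 - Real.cos θ) +
        β * Real.log (1 + Real.cos θ) : ℝ) : ℂ) / (z - (Real.cos θ : ℂ))) := fun z hz => by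
    rw [hD, hint, eq_sqrtBranch hsq_an hsq_sq hsq_pos (sub_one_mem_slitPlane hz)]
  have hsqrt : ((Real.sqrt (w x) : ℝ) : ℂ) = Complex.exp ((Real.log (w x) / 2 : ℝ) : ℂ) := by
    rw [← Complex.ofReal_exp, Real.exp_half, Real.exp_log (hwpos x hx)]
  have hup : Tendsto D (nhdsWithin (x : ℂ) {z : ℂ | 0 < z.im})
      (nhds (((Real.sqrt (w x) : ℝ) : ℂ) * Complex.exp (Complex.I *
        ((Real.pi * α / 2 - (α + β) / 2 * Real.arccos x - hbar x : ℝ) : ℂ)))) := by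
    have := (tendsto_szego_exponent hL α β hx (hhbar x hx)).cexp
    rw [← hlog x hx, Complex.exp_add, ← hsqrt] at this
    refine this.congr' ?_
    filter_upwards [self_mem_nhdsWithin] with z hz
    exact (hDz z (ne_of_gt hz)).symm
  refine ⟨hup, ?_⟩
  have hconj : ∀ z : ℂ, z.im ≠ 0 → D ((starRingEnd ℂ) z) = (starRingEnd ℂ) (D z) := by
    intro z hz
    rw [hDz z hz, hDz _ (by simpa using hz), ← Complex.exp_conj, map_mul, map_div₀, map_mul,
      sqrtBranch_conj hz, ← integral_conj, Complex.conj_ofReal, map_ofNat]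
    simp only [map_div₀, map_sub, Complex.conj_ofReal]
  have hlow := tendsto_conj_lower hconj hup
  rwa [map_mul, Complex.conj_ofReal, ← Complex.exp_conj, map_mul, Complex.conj_I,
    Complex.conj_ofReal] at hlow
end

section
/- Let c > 0 and let Ξ_c be the step function equal to 1 on [-1,0) and c² on [0,1]. Its Szegő function D(·, Ξ_c) satisfies: for every x ∈ (-1,0)∪(0,1), lim_{z→x, ±Im z>0} D(z, Ξ_c) = √(Ξ_c(x))·exp( ∓ i·((log c)/π)·log| (1 + √(1-x²))/x | ); moreover, as z → 0 with ±Im z > 0, D(z, Ξ_c) = c^{1 ± (i/π)·log(z/2)}·(1 + o(1)), where log denotes the principal branch. -/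
open Filter Set MeasureTheory
open scoped ComplexConjugate

lemma Complex.log_div_of_im_pos {a b : ℂ} (ha : 0 < a.im) (hb : 0 < b.im) :
    Complex.log (a / b) = Complex.log a - Complex.log b := by
  have ha0 : a ≠ 0 := by rintro rfl; simp at ha
  have hb0 : b ≠ 0 := by rintro rfl; simp at hb
  have h1 := Complex.arg_nonneg_iff.2 ha.le
  have h2 := Complex.arg_nonneg_iff.2 hb.le
  have h3 : a.arg < Real.pi := Complex.arg_lt_pi_iff.2 (Or.inr ha.ne')
  have h4 : b.arg < Real.pi := Complex.arg_lt_pi_iff.2 (Or.inr hb.ne')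
  rw [← Complex.log_exp (x := Complex.log a - Complex.log b), Complex.exp_sub,
    Complex.exp_log ha0, Complex.exp_log hb0]
  · simp only [Complex.sub_im, Complex.log_im]; linarith
  · simp only [Complex.sub_im, Complex.log_im]; linarith

lemma intervalIntegrable_inv_sqrt_div (k : ℝ) {z : ℂ} (hz : 0 < z.im) :
    IntervalIntegrable (fun t : ℝ => ((k / √(1 - t ^ 2) : ℝ) : ℂ) / (z - t)) volume (-1) 1 := by
  have hne : ∀ t : ℝ, z - t ≠ 0 := fun t h => by
    have := congrArg Complex.im h
    simp at this
    exact hz.ne' this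
  have h := Polynomial.Chebyshev.intervalIntegrable_sqrt_one_sub_sq_inv
  have h2 : IntervalIntegrable (fun t : ℝ => ((√(1 - t ^ 2)⁻¹ : ℝ) : ℂ)) volume (-1) 1 :=
    ⟨h.1.ofReal, h.2.ofReal⟩
  refine (h2.mul_continuousOn (g := fun t : ℝ => (k : ℂ) / (z - t)) ?_).congr ?_
  · exact (Continuous.div (by fun_prop) (by fun_prop) hne).continuousOn
  · intro t _
    simp only [Real.sqrt_inv, Complex.ofReal_div, Complex.ofReal_inv]
    ring

lemma tan_half_im_pos {z w : ℂ} (hz : 0 < z.im) (hw : w ^ 2 = 1 - z ^ 2) (hre : 0 < w.re) :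
    0 < (z / (1 + w)).im := by
  have hre' := congrArg Complex.re hw
  have him' := congrArg Complex.im hw
  simp [pow_two] at hre' him'
  have h1 : (1 + w) ≠ 0 := fun h => by
    have := congrArg Complex.re h
    simp at this; linarith
  have hN : 0 < Complex.normSq (1 + w) := Complex.normSq_pos.2 h1
  rw [Complex.div_im, ← sub_div]
  apply div_pos _ hN
  simp only [Complex.add_re, Complex.add_im, Complex.one_re, Complex.one_im, zero_add]
  have h2 : 0 < w.re * (z.im * (1 + w.re) - z.re * w.im) := by
    have : 0 < z.im * w.re * (1 + w.re) + z.re ^ 2 * z.im := by positivity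
    linear_combination this + z.re / 2 * him'
  exact pos_of_mul_pos_right h2 hre.le

lemma mul_integral_inv_sqrt_div {z w : ℂ} (hz : 0 < z.im) (hw : w ^ 2 = 1 - z ^ 2)
    (hre : 0 < w.re) :
    w * ∫ t in (0 : ℝ)..1, ((1 / √(1 - t ^ 2) : ℝ) : ℂ) / (z - t) =
      Complex.log (z / (1 + w)) - Real.pi * Complex.I := by
  have hp := tan_half_im_pos hz hw hre
  have h1 : (1 + w) ≠ 0 := fun h => by
    have := congrArg Complex.re h
    simp at this; linarith
  have hne : ∀ t : ℝ, z - t ≠ 0 := fun t h => by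
    have := congrArg Complex.im h
    simp at this
    exact hz.ne' this
  set p := z / (1 + w) with hpdef
  clear_value p
  have hpz : z = p * (1 + w) := by rw [hpdef]; field_simp
  have hp2 : p ^ 2 * (1 + w) = 1 - w := by
    apply mul_right_cancel₀ h1
    linear_combination (-(p * (1 + w)) - z) * hpz + hw
  have hden : ∀ t ∈ Icc (0 : ℝ) 1, (1 + √(1 - t ^ 2) - p * t : ℂ) ≠ 0 := fun t ht h => by
    have h2 := congrArg Complex.im h
    have h3 := congrArg Complex.re h
    simp at h2 h3
    rcases h2 with h2 | h2
    · exact hp.ne' h2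
    · have := Real.sqrt_nonneg (1 - t ^ 2)
      simp [h2] at h3
  have hnum : ∀ t ∈ Icc (0 : ℝ) 1, (p * (1 + √(1 - t ^ 2)) - t : ℂ) ≠ 0 := fun t ht h => by
    have h2 := congrArg Complex.im h
    have := Real.sqrt_nonneg (1 - t ^ 2)
    simp at h2
    rcases h2 with h2 | h2
    · exact hp.ne' h2
    · linarith
  set m : ℝ → ℂ := fun t => (p * (1 + √(1 - t ^ 2)) - t) / (1 + √(1 - t ^ 2) - p * t) with hm
  have hm1 : m 1 = -1 := by
    have := hden 1 (by simp)
    simp [hm] at this ⊢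
    rw [div_eq_iff this]; ring
  have hm0 : m 0 = p := by
    simp [hm]
  have hmim : ∀ t ∈ Ico (0 : ℝ) 1, 0 < (m t).im := fun t ht => by
    have hN : 0 < Complex.normSq (1 + √(1 - t ^ 2) - p * t) :=
      Complex.normSq_pos.2 (hden t (Ico_subset_Icc_self ht))
    have hs : 0 < √(1 - t ^ 2) := Real.sqrt_pos.2 (by nlinarith [ht.1, ht.2])
    have hs2 : √(1 - t ^ 2) ^ 2 = 1 - t ^ 2 := Real.sq_sqrt (by nlinarith [ht.1, ht.2])
    simp only [hm]
    rw [Complex.div_im, ← sub_div]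
    apply div_pos _ hN
    simp
    generalize √(1 - t ^ 2) = s at *
    have : 0 < p.im * (2 * s * (1 + s)) := by positivity
    refine this.trans_eq ?_
    linear_combination p.im * hs2
  have hslit : ∀ t ∈ Icc (0 : ℝ) 1, m t / Complex.I ∈ Complex.slitPlane := fun t ht => by
    rcases ht.2.lt_or_eq with h | rfl
    · left
      simpa [Complex.div_I] using hmim t ⟨ht.1, h⟩
    · right; simp [hm1, Complex.div_I]
  have hcont : ContinuousOn (fun t => Complex.log (m t / Complex.I)) (Icc 0 1) := by
    refine ContinuousOn.clog (ContinuousOn.div_const (ContinuousOn.div ?_ ?_ hden) _) hslit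
    · fun_prop
    · fun_prop
  have hderiv : ∀ t ∈ Ioo (0 : ℝ) 1, HasDerivAt (fun t => Complex.log (m t / Complex.I))
      (-w * (((1 / √(1 - t ^ 2) : ℝ) : ℂ) / (z - t))) t := fun t ht => by
    have hs : 0 < √(1 - t ^ 2) := Real.sqrt_pos.2 (by nlinarith [ht.1, ht.2])
    have hs2 : √(1 - t ^ 2) ^ 2 = 1 - t ^ 2 := Real.sq_sqrt (by nlinarith [ht.1, ht.2])
    have ht' := Ioo_subset_Icc_self ht
    have d1 : HasDerivAt (fun t : ℝ => √(1 - t ^ 2)) (-t / √(1 - t ^ 2)) t := by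
      have := (((hasDerivAt_id t).pow 2).const_sub 1).sqrt (by simp; nlinarith [ht.1, ht.2])
      convert this using 1
      simp; field_simp; simp; field_simp
    have d1' := d1.ofReal_comp
    have dt : HasDerivAt (fun t : ℝ => (t : ℂ)) 1 t := (hasDerivAt_id t).ofReal_comp
    have d2 : HasDerivAt m _ t :=
      (((d1'.const_add 1).const_mul p).sub dt).div ((d1'.const_add 1).sub (dt.const_mul p))
        (hden t ht')
    have d3 := (d2.div_const Complex.I).clog_real (hslit t ht')
    convert d3 using 1
    have hd := hden t ht'
    have hn := hnum t ht'
    have hz' := hne t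
    have hs0 : (√(1 - t ^ 2) : ℂ) ≠ 0 := by exact_mod_cast hs.ne'
    have hs1 : (1 + √(1 - t ^ 2) : ℂ) ≠ 0 := by exact_mod_cast (by positivity : (1 + √(1 - t ^ 2)) ≠ 0)
    have hs2' : (√(1 - t ^ 2) : ℂ) ^ 2 = 1 - t ^ 2 := by exact_mod_cast hs2
    simp only [hm, Pi.sub_apply]
    push_cast
    generalize (√(1 - t ^ 2) : ℂ) = s at *
    have hND : (p * (1 + s) - t) * (1 + s - p * t) * (1 + w) = 2 * (1 + s) * (z - t) := by
      linear_combination p * (1 + w) * hs2' - 2 * (1 + s) * hpz - (1 + s) * t * hp2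
    rw [div_div_div_cancel_right₀ Complex.I_ne_zero]
    have hN' : (p * (-t / s) - 1) * (1 + s - p * t) - (p * (1 + s) - t) * (-t / s - p * 1) =
        -((1 - p ^ 2) * (1 + s)) / s := by
      field_simp
      linear_combination (p ^ 2 - 1) * hs2'
    rw [hN', div_div (-((1 - p ^ 2) * (1 + s)) / s), show (1 + s - p * t) ^ 2 * ((p * (1 + s) - t) / (1 + s - p * t)) =
        (p * (1 + s) - t) * (1 + s - p * t) by field_simp, (eq_div_iff h1).2 hND]
    field_simp
    linear_combination -hp2
  have hint : IntervalIntegrable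
      (fun t : ℝ => -w * (((1 / √(1 - t ^ 2) : ℝ) : ℂ) / (z - t))) volume 0 1 :=
    ((intervalIntegrable_inv_sqrt_div 1 hz).mono_set (by
      rw [uIcc_of_le zero_le_one, uIcc_of_le (by norm_num)]
      exact Icc_subset_Icc (by norm_num) le_rfl)).const_mul _
  have key := intervalIntegral.integral_eq_sub_of_hasDerivAt_of_le zero_le_one hcont hderiv hint
  rw [intervalIntegral.integral_const_mul, hm1, hm0, Complex.log_div_of_im_pos hp (by simp)] at key
  have hI : (-1 : ℂ) / Complex.I = Complex.I := by simp
  rw [hI, Complex.log_I] at key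
  linear_combination -key

/-- The square root of `1 - z ^ 2` with positive real part off the real axis. -/
noncomputable def sqrtOneSubSq (z : ℂ) : ℂ := Complex.exp (Complex.log (1 - z ^ 2) / 2)

lemma one_sub_sq_mem_slitPlane {z : ℂ} (hz : z.im ≠ 0) : 1 - z ^ 2 ∈ Complex.slitPlane := by
  by_cases h : z.re = 0
  · left
    simp [pow_two, h]
    nlinarith [mul_self_nonneg z.im]
  · right
    simp [pow_two]
    intro h'
    apply mul_ne_zero h hz
    linarith

lemma one_sub_ofReal_sq_mem_slitPlane {x : ℝ} (hx : x ∈ Ioo (-1 : ℝ) 1) :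
    1 - (x : ℂ) ^ 2 ∈ Complex.slitPlane := by
  have : 0 < 1 - x ^ 2 := by nlinarith [hx.1, hx.2]
  exact_mod_cast Complex.ofReal_mem_slitPlane.2 this

lemma sqrtOneSubSq_sq {z : ℂ} (hz : 1 - z ^ 2 ∈ Complex.slitPlane) :
    sqrtOneSubSq z ^ 2 = 1 - z ^ 2 := by
  rw [sqrtOneSubSq, ← Complex.exp_nat_mul, Nat.cast_ofNat, mul_div_cancel₀ _ two_ne_zero,
    Complex.exp_log (Complex.slitPlane_ne_zero hz)]

lemma sqrtOneSubSq_re_pos {z : ℂ} (hz : 1 - z ^ 2 ∈ Complex.slitPlane) :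
    0 < (sqrtOneSubSq z).re := by
  rw [sqrtOneSubSq, Complex.exp_re]
  refine mul_pos (Real.exp_pos _) (Real.cos_pos_of_mem_Ioo ?_)
  have him : (Complex.log (1 - z ^ 2) / 2).im = (1 - z ^ 2).arg / 2 := by
    rw [← Complex.log_im]
    exact Complex.div_ofNat_im _ 2
  rw [him]
  have h1 := Complex.neg_pi_lt_arg (1 - z ^ 2)
  have h2 := lt_of_le_of_ne (Complex.arg_le_pi (1 - z ^ 2)) (Complex.slitPlane_arg_ne_pi hz)
  constructor <;> linarith

lemma continuousAt_sqrtOneSubSq {z : ℂ} (hz : 1 - z ^ 2 ∈ Complex.slitPlane) :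
    ContinuousAt sqrtOneSubSq z := by
  have : ContinuousAt (fun z : ℂ => 1 - z ^ 2) z := by fun_prop
  exact ((this.clog hz).div_const 2).cexp

lemma sqrtOneSubSq_ofReal {x : ℝ} (hx : x ∈ Ioo (-1 : ℝ) 1) :
    sqrtOneSubSq x = (√(1 - x ^ 2) : ℝ) := by
  have hpos : 0 < 1 - x ^ 2 := by nlinarith [hx.1, hx.2]
  rw [sqrtOneSubSq, ← Real.exp_log (Real.sqrt_pos.2 hpos), Real.log_sqrt hpos.le]
  push_cast
  rw [Complex.ofReal_log hpos.le]
  push_cast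
  rfl

lemma one_add_sqrtOneSubSq_ne_zero {z : ℂ} (hz : 1 - z ^ 2 ∈ Complex.slitPlane) :
    1 + sqrtOneSubSq z ≠ 0 := fun h => by
  have := congrArg Complex.re h
  have := sqrtOneSubSq_re_pos hz
  simp at *
  linarith

lemma tan_half_sqrtOneSubSq_im_pos {z : ℂ} (hz : 0 < z.im) :
    0 < (z / (1 + sqrtOneSubSq z)).im :=
  tan_half_im_pos hz (sqrtOneSubSq_sq (one_sub_sq_mem_slitPlane hz.ne'))
    (sqrtOneSubSq_re_pos (one_sub_sq_mem_slitPlane hz.ne'))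

lemma eq_I_mul_sqrtOneSubSq {sq : ℂ → ℂ}
    (hsq_cont : ContinuousOn sq ({z : ℂ | z.im = 0 ∧ |z.re| ≤ 1}ᶜ))
    (hsq_sq : ∀ z ∈ ({z : ℂ | z.im = 0 ∧ |z.re| ≤ 1}ᶜ : Set ℂ), sq z ^ 2 = z ^ 2 - 1)
    (hsq_pos : ∀ x : ℝ, 1 < x → sq (x : ℂ) = ((Real.sqrt (x ^ 2 - 1) : ℝ) : ℂ))
    {z : ℂ} (hz : 0 < z.im) : sq z = Complex.I * sqrtOneSubSq z := by
  have hsub : {z : ℂ | 0 < z.im} ⊆ {z : ℂ | z.im = 0 ∧ |z.re| ≤ 1}ᶜ :=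
    fun z hz h => hz.ne' h.1
  have hw : ∀ {z : ℂ}, 0 < z.im → 1 - z ^ 2 ∈ Complex.slitPlane :=
    fun hz => one_sub_sq_mem_slitPlane hz.ne'
  have hconn : IsPreconnected {z : ℂ | 0 < z.im} :=
    (convex_halfSpace_im_gt 0).isPreconnected
  rcases hconn.eq_or_eq_neg_of_sq_eq (f := sq) (g := fun z => Complex.I * sqrtOneSubSq z)
    (hsq_cont.mono hsub)
    (fun z hz => ((continuousAt_sqrtOneSubSq (hw hz)).const_mul _).continuousWithinAt)
    (fun z hz => by
      simp only [Pi.pow_apply]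
      rw [hsq_sq z (hsub hz), mul_pow, sqrtOneSubSq_sq (hw hz), Complex.I_sq]
      ring)
    (fun {z} hz => mul_ne_zero Complex.I_ne_zero (Complex.exp_ne_zero _)) with h | h
  · exact h hz
  · exfalso
    have h2 : (2 : ℂ) ∈ ({z : ℂ | z.im = 0 ∧ |z.re| ≤ 1}ᶜ : Set ℂ) := by
      intro h
      have := h.2
      norm_num at this
    have hopen : IsOpen ({z : ℂ | z.im = 0 ∧ |z.re| ≤ 1}ᶜ : Set ℂ) := by
      refine IsClosed.isOpen_compl (self := ?_)
      exact (isClosed_eq Complex.continuous_im continuous_const).inter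
        (isClosed_le Complex.continuous_re.abs continuous_const)
    have hc2 : ContinuousAt sq 2 := hsq_cont.continuousAt (hopen.mem_nhds h2)
    have hpath : Tendsto (fun ε : ℝ => (2 + ε * Complex.I : ℂ)) (nhdsWithin 0 (Ioi 0)) (nhds 2) := by
      have : Continuous (fun ε : ℝ => (2 + ε * Complex.I : ℂ)) := by fun_prop
      have := (this.tendsto 0).mono_left (nhdsWithin_le_nhds (s := Ioi 0))
      simpa using this
    have hlim := (Complex.continuous_re.tendsto _).comp (hc2.tendsto.comp hpath)
    have hle : (sq 2).re ≤ 0 := by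
      refine le_of_tendsto hlim ?_
      filter_upwards [self_mem_nhdsWithin] with ε hε
      have hε : 0 < ε := hε
      have hεim : 0 < (2 + ε * Complex.I : ℂ).im := by simpa using hε
      have h3 := h hεim
      have h4 := congrArg Complex.im (sqrtOneSubSq_sq (hw hεim))
      have h5 := sqrtOneSubSq_re_pos (hw hεim)
      simp only [Function.comp, h3, Pi.neg_apply]
      simp [pow_two] at h4 ⊢
      nlinarith
    have h6 := hsq_pos 2 (by norm_num)
    norm_num at h6
    rw [h6, Complex.ofReal_re] at hle
    exact absurd hle (not_le.2 (Real.sqrt_pos.2 (by norm_num)))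

lemma integral_step_div {k : ℝ} {z : ℂ} (hz : 0 < z.im) :
    ∫ t in (-1 : ℝ)..1, ((Real.log (if t < 0 then 1 else k) / √(1 - t ^ 2) : ℝ) : ℂ) / (z - t) =
      Real.log k * ∫ t in (0 : ℝ)..1, ((1 / √(1 - t ^ 2) : ℝ) : ℂ) / (z - t) := by
  have hzero : EqOn (fun t : ℝ => ((Real.log (if t < 0 then 1 else k) / √(1 - t ^ 2) : ℝ) : ℂ) /
      (z - t)) 0 (Ioo (-1) 0) := fun t ht => by simp [ht.2]
  have hconst : EqOn (fun t : ℝ => ((Real.log (if t < 0 then 1 else k) / √(1 - t ^ 2) : ℝ) : ℂ) /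
      (z - t)) (fun t : ℝ => Real.log k * (((1 / √(1 - t ^ 2) : ℝ) : ℂ) / (z - t))) (uIcc 0 1) :=
    fun t ht => by
      rw [uIcc_of_le zero_le_one] at ht
      simp only [not_lt.2 ht.1, if_false]
      push_cast
      ring
  have hint : IntervalIntegrable
      (fun t : ℝ => Real.log k * (((1 / √(1 - t ^ 2) : ℝ) : ℂ) / (z - t))) volume 0 1 :=
    ((intervalIntegrable_inv_sqrt_div 1 hz).mono_set (by
      rw [uIcc_of_le zero_le_one, uIcc_of_le (by norm_num)]
      exact Icc_subset_Icc (by norm_num) le_rfl)).const_mul _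
  have hint0 : IntervalIntegrable (fun t : ℝ =>
      ((Real.log (if t < 0 then 1 else k) / √(1 - t ^ 2) : ℝ) : ℂ) / (z - t)) volume (-1) 0 := by
    rw [intervalIntegrable_iff_integrableOn_Ioo_of_le (by norm_num)]
    exact integrableOn_zero.congr_fun (fun t ht => (hzero ht).symm) measurableSet_Ioo
  rw [← intervalIntegral.integral_add_adjacent_intervals hint0
    (hint.congr fun t ht => (hconst (uIoc_subset_uIcc ht)).symm), intervalIntegral.integral_congr hconst,
    intervalIntegral.integral_const_mul, intervalIntegral.integral_of_le (by norm_num),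
    integral_Ioc_eq_integral_Ioo, setIntegral_congr_fun measurableSet_Ioo hzero]
  simp

lemma szego_exponent_eq {c : ℝ} {sq : ℂ → ℂ}
    (hsq_cont : ContinuousOn sq ({z : ℂ | z.im = 0 ∧ |z.re| ≤ 1}ᶜ))
    (hsq_sq : ∀ z ∈ ({z : ℂ | z.im = 0 ∧ |z.re| ≤ 1}ᶜ : Set ℂ), sq z ^ 2 = z ^ 2 - 1)
    (hsq_pos : ∀ x : ℝ, 1 < x → sq (x : ℂ) = ((Real.sqrt (x ^ 2 - 1) : ℝ) : ℂ))
    {z : ℂ} (hz : 0 < z.im) :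
    sq z / (2 * (Real.pi : ℂ)) * ∫ t in (-1 : ℝ)..1,
      ((Real.log (if t < 0 then 1 else c ^ 2) / Real.sqrt (1 - t ^ 2) : ℝ) : ℂ) / (z - (t : ℂ)) =
    Real.log c * (1 + Complex.I / Real.pi * Complex.log (z / (1 + sqrtOneSubSq z))) := by
  have hw := one_sub_sq_mem_slitPlane hz.ne'
  have key := mul_integral_inv_sqrt_div hz (sqrtOneSubSq_sq hw) (sqrtOneSubSq_re_pos hw)
  have hpi : (Real.pi : ℂ) ≠ 0 := by exact_mod_cast Real.pi_ne_zero
  rw [integral_step_div hz, eq_I_mul_sqrtOneSubSq hsq_cont hsq_sq hsq_pos hz, Real.log_pow]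
  generalize (∫ t in (0 : ℝ)..1, ((1 / √(1 - t ^ 2) : ℝ) : ℂ) / (z - t)) = J at key ⊢
  push_cast
  field_simp
  linear_combination (Complex.I * Real.log c) * key - Real.log c * Real.pi * Complex.I_sq

lemma tendsto_log_of_im_pos {α : Type*} {l : Filter α} {f : α → ℂ} {y : ℝ} (hy : y ≠ 0)
    (hf : Tendsto f l (nhds y)) (hpos : ∀ᶠ a in l, 0 < (f a).im) :
    Tendsto (fun a => Complex.log (f a)) l
      (nhds (Real.log |y| + if y < 0 then Real.pi * Complex.I else 0)) := by
  split_ifs with h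
  · have h1 := Complex.tendsto_log_nhdsWithin_im_nonneg_of_re_neg_of_im_zero (z := y)
      (by simpa) (by simp)
    have := h1.comp (tendsto_nhdsWithin_iff.2 ⟨hf, hpos.mono fun a ha => ha.le⟩)
    simpa [Function.comp_def] using this
  · have hy' : 0 < y := lt_of_le_of_ne (not_lt.1 h) hy.symm
    have := (continuousAt_clog (Complex.ofReal_mem_slitPlane.2 hy')).tendsto.comp hf
    simpa [Function.comp_def, abs_of_pos hy', Complex.ofReal_log hy'.le] using this

lemma szego_step_upper {c : ℝ} (hc : 0 < c) {sq : ℂ → ℂ}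
    (hsq_cont : ContinuousOn sq ({z : ℂ | z.im = 0 ∧ |z.re| ≤ 1}ᶜ))
    (hsq_sq : ∀ z ∈ ({z : ℂ | z.im = 0 ∧ |z.re| ≤ 1}ᶜ : Set ℂ), sq z ^ 2 = z ^ 2 - 1)
    (hsq_pos : ∀ x : ℝ, 1 < x → sq (x : ℂ) = ((Real.sqrt (x ^ 2 - 1) : ℝ) : ℂ))
    {D : ℂ → ℂ}
    (hD : ∀ z : ℂ, D z =
      Complex.exp (sq z / (2 * (Real.pi : ℂ)) *
        ∫ t in (-1 : ℝ)..1,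
          ((Real.log (if t < 0 then 1 else c ^ 2) / Real.sqrt (1 - t ^ 2) : ℝ) : ℂ) /
            (z - (t : ℂ)))) :
    (∀ x ∈ Ioo (-1 : ℝ) 1, x ≠ 0 →
      Tendsto D (nhdsWithin (x : ℂ) {z : ℂ | 0 < z.im})
        (nhds (((Real.sqrt (if x < 0 then 1 else c ^ 2) : ℝ) : ℂ) *
          Complex.exp (-Complex.I *
            ((Real.log c / Real.pi * Real.log |(1 + Real.sqrt (1 - x ^ 2)) / x| : ℝ) : ℂ))))) ∧
    Tendsto (fun z : ℂ => D z / (c : ℂ) ^ (1 + Complex.I / (Real.pi : ℂ) * Complex.log (z / 2)))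
      (nhdsWithin 0 {z : ℂ | 0 < z.im}) (nhds 1) := by
  have hpi : (Real.pi : ℂ) ≠ 0 := by exact_mod_cast Real.pi_ne_zero
  have hDz : ∀ {z : ℂ}, 0 < z.im → D z = Complex.exp (Real.log c *
      (1 + Complex.I / Real.pi * Complex.log (z / (1 + sqrtOneSubSq z)))) := fun {z} hz => by
    rw [hD, szego_exponent_eq hsq_cont hsq_sq hsq_pos hz]
  constructor
  · intro x hx hx0
    have hs := one_sub_ofReal_sq_mem_slitPlane hx
    have hd : 0 < 1 + √(1 - x ^ 2) := by positivity
    have hlim : Tendsto (fun z : ℂ => z / (1 + sqrtOneSubSq z))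
        (nhdsWithin (x : ℂ) {z : ℂ | 0 < z.im}) (nhds ((x / (1 + √(1 - x ^ 2)) : ℝ) : ℂ)) := by
      have : ContinuousAt (fun z : ℂ => z / (1 + sqrtOneSubSq z)) x :=
        continuousAt_id.div ((continuousAt_sqrtOneSubSq hs).const_add 1)
          (one_add_sqrtOneSubSq_ne_zero hs)
      have := this.tendsto.mono_left (nhdsWithin_le_nhds (s := {z : ℂ | 0 < z.im}))
      simpa [sqrtOneSubSq_ofReal hx] using this
    have hlog := tendsto_log_of_im_pos (div_ne_zero hx0 hd.ne') hlim
      (by filter_upwards [self_mem_nhdsWithin] with z hz using tan_half_sqrtOneSubSq_im_pos hz)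
    have hfin := (((hlog.const_mul (Complex.I / Real.pi)).const_add 1).const_mul
      (Real.log c : ℂ)).cexp
    refine (hfin.congr' ?_).trans_eq ?_
    · filter_upwards [self_mem_nhdsWithin] with z hz using (hDz hz).symm
    · congr 1
      have hinv : Real.log |x / (1 + √(1 - x ^ 2))| = -Real.log |(1 + √(1 - x ^ 2)) / x| := by
        rw [← Real.log_inv, ← abs_inv, inv_div]
      have hneg : x / (1 + √(1 - x ^ 2)) < 0 ↔ x < 0 := by
        rw [div_lt_iff₀ hd, zero_mul]
      rw [hinv]
      simp only [hneg]
      split_ifs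
      · rw [Real.sqrt_one, Complex.ofReal_one, one_mul]
        congr 1
        push_cast
        field_simp
        linear_combination (Real.log c * Real.pi : ℂ) * Complex.I_sq
      · rw [Real.sqrt_sq hc.le, ← Real.exp_log hc, Complex.ofReal_exp, ← Complex.exp_add,
          Real.exp_log hc]
        congr 1
        push_cast
        field_simp
        ring
  · have hs : 1 - (0 : ℂ) ^ 2 ∈ Complex.slitPlane := by simp
    have hw0 : sqrtOneSubSq 0 = 1 := by simp [sqrtOneSubSq]
    have hlim : Tendsto (fun z : ℂ => Complex.log (2 / (1 + sqrtOneSubSq z)))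
        (nhdsWithin 0 {z : ℂ | 0 < z.im}) (nhds 0) := by
      have : ContinuousAt (fun z : ℂ => Complex.log (2 / (1 + sqrtOneSubSq z))) 0 :=
        (continuousAt_const.div ((continuousAt_sqrtOneSubSq hs).const_add 1)
          (one_add_sqrtOneSubSq_ne_zero hs)).clog (by norm_num [hw0])
      have := this.tendsto.mono_left (nhdsWithin_le_nhds (s := {z : ℂ | 0 < z.im}))
      norm_num [hw0] at this
      exact this
    have hfin := ((hlim.const_mul (Complex.I / Real.pi)).const_mul (Real.log c : ℂ)).cexp
    simp only [mul_zero, Complex.exp_zero] at hfin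
    refine hfin.congr' ?_
    filter_upwards [self_mem_nhdsWithin] with z hz
    have hz : 0 < z.im := hz
    have hz0 : z ≠ 0 := by rintro rfl; simp at hz
    have h2 : 0 < (z / 2).im := by
      rw [Complex.div_ofNat_im]; positivity
    have hdiv : 2 / (1 + sqrtOneSubSq z) = z / (1 + sqrtOneSubSq z) / (z / 2) := by
      have := one_add_sqrtOneSubSq_ne_zero (one_sub_sq_mem_slitPlane hz.ne')
      field_simp
    rw [hDz hz, hdiv, Complex.log_div_of_im_pos (tan_half_sqrtOneSubSq_im_pos hz) h2,
      Complex.cpow_def_of_ne_zero (by exact_mod_cast hc.ne'), ← Complex.exp_sub,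
      Complex.ofReal_log hc.le]
    congr 1
    ring

theorem stmt16
    (c : ℝ) (hc : 0 < c)
    -- the branch of √(z²-1), analytic off [-1,1] and positive on (1,∞)
    (sq : ℂ → ℂ)
    (hsq_an : AnalyticOnNhd ℂ sq ({z : ℂ | z.im = 0 ∧ |z.re| ≤ 1}ᶜ))
    (hsq_sq : ∀ z ∈ ({z : ℂ | z.im = 0 ∧ |z.re| ≤ 1}ᶜ : Set ℂ), sq z ^ 2 = z ^ 2 - 1)
    (hsq_pos : ∀ x : ℝ, 1 < x → sq (x : ℂ) = ((Real.sqrt (x ^ 2 - 1) : ℝ) : ℂ))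
    -- the Szegő function of the step function Ξ_c (= 1 on [-1,0), = c² on [0,1])
    (D : ℂ → ℂ)
    (hD : ∀ z : ℂ, D z =
      Complex.exp (sq z / (2 * (Real.pi : ℂ)) *
        ∫ t in (-1 : ℝ)..1,
          ((Real.log (if t < 0 then 1 else c ^ 2) / Real.sqrt (1 - t ^ 2) : ℝ) : ℂ) /
            (z - (t : ℂ)))) :
    -- boundary behavior on (-1,0)∪(0,1)
    (∀ x ∈ Ioo (-1 : ℝ) 1, x ≠ 0 →
      Tendsto D (nhdsWithin (x : ℂ) {z : ℂ | 0 < z.im})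
        (nhds (((Real.sqrt (if x < 0 then 1 else c ^ 2) : ℝ) : ℂ) *
          Complex.exp (-Complex.I *
            ((Real.log c / Real.pi * Real.log |(1 + Real.sqrt (1 - x ^ 2)) / x| : ℝ) : ℂ)))) ∧
      Tendsto D (nhdsWithin (x : ℂ) {z : ℂ | z.im < 0})
        (nhds (((Real.sqrt (if x < 0 then 1 else c ^ 2) : ℝ) : ℂ) *
          Complex.exp (Complex.I *
            ((Real.log c / Real.pi * Real.log |(1 + Real.sqrt (1 - x ^ 2)) / x| : ℝ) : ℂ))))) ∧
    -- behavior at the origin: D(z) = c^{1 ± (i/π)·log(z/2)}·(1+o(1)) as z → 0, ±Im z > 0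
    Tendsto (fun z : ℂ => D z / (c : ℂ) ^ (1 + Complex.I / (Real.pi : ℂ) * Complex.log (z / 2)))
      (nhdsWithin 0 {z : ℂ | 0 < z.im}) (nhds 1) ∧
    Tendsto (fun z : ℂ => D z / (c : ℂ) ^ (1 - Complex.I / (Real.pi : ℂ) * Complex.log (z / 2)))
      (nhdsWithin 0 {z : ℂ | z.im < 0}) (nhds 1) := by
  have hcont := hsq_an.continuousOn
  obtain ⟨hup, hup0⟩ := szego_step_upper hc hcont hsq_sq hsq_pos hD
  have hmem : ∀ z ∈ ({z : ℂ | z.im = 0 ∧ |z.re| ≤ 1}ᶜ : Set ℂ),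
      conj z ∈ ({z : ℂ | z.im = 0 ∧ |z.re| ≤ 1}ᶜ : Set ℂ) := fun z hz => by simpa using hz
  obtain ⟨hlow, hlow0⟩ := szego_step_upper hc (sq := fun z => conj (sq (conj z)))
    (D := fun z => conj (D (conj z)))
    (Complex.continuous_conj.comp_continuousOn
      (hcont.comp Complex.continuous_conj.continuousOn hmem))
    (fun z hz => by rw [← map_pow, hsq_sq _ (hmem z hz)]; simp)
    (fun x hx => by rw [Complex.conj_ofReal, hsq_pos x hx, Complex.conj_ofReal])
    (fun z => by
      rw [hD, ← Complex.exp_conj, map_mul, ← intervalIntegral.intervalIntegral_conj]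
      simp [map_ofNat])
  have hconj : ∀ x : ℝ, Tendsto (fun z : ℂ => conj z) (nhdsWithin (x : ℂ) {z : ℂ | z.im < 0})
      (nhdsWithin (x : ℂ) {z : ℂ | 0 < z.im}) := fun x => by
    refine tendsto_nhdsWithin_iff.2 ⟨?_, ?_⟩
    · have := (Complex.continuous_conj.tendsto (x : ℂ)).mono_left
        (nhdsWithin_le_nhds (s := {z : ℂ | z.im < 0}))
      simpa using this
    · filter_upwards [self_mem_nhdsWithin] with z hz
      simpa using hz
  refine ⟨fun x hx hx0 => ⟨hup x hx hx0, ?_⟩, hup0, ?_⟩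
  · have h := (Complex.continuous_conj.tendsto _).comp ((hlow x hx hx0).comp (hconj x))
    simpa [Function.comp_def, ← Complex.exp_conj] using h
  · have h0 := hconj 0
    rw [Complex.ofReal_zero] at h0
    have h := (Complex.continuous_conj.tendsto _).comp (hlow0.comp h0)
    rw [map_one] at h
    refine h.congr' ?_
    filter_upwards [self_mem_nhdsWithin] with z hz
    have hz : z.im < 0 := hz
    have harg : (z / 2).arg ≠ Real.pi := fun h => by
      have := (Complex.arg_eq_pi_iff.1 h).2
      rw [Complex.div_ofNat_im] at this
      linarith
    have hcarg : (c : ℂ).arg ≠ Real.pi := by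
      rw [Complex.arg_ofReal_of_nonneg hc.le]; exact Real.pi_ne_zero.symm
    have hconj2 : conj z / 2 = conj (z / 2) := by simp [map_ofNat]
    simp only [Function.comp_apply, map_div₀, Complex.conj_conj]
    have hcpow := Complex.cpow_conj c
      (1 + Complex.I / Real.pi * conj (Complex.log (z / 2))) hcarg
    rw [Complex.conj_ofReal] at hcpow
    rw [hconj2, Complex.log_conj _ harg, ← hcpow]
    simp [sub_eq_add_neg, neg_div]
end

section
/- Let c > 0 and λ = i·log(c)/π. For every z ∈ ℂ∖[-1,1], the Szegő function of the step function Ξ_c is given explicitly by D(z, Ξ_c) = c·exp( −λ·log( (1 − i√(z²-1))/z ) ), where √(z²-1) is the branch analytic on ℂ∖[-1,1] and positive for z > 1, and log is the principal branch (the map z ↦ (1 − i√(z²-1))/z sends ℂ∖[-1,1] into the lower half plane, so the principal logarithm is defined). -/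
open Filter Set MeasureTheory

/-- A combination of logarithms on the lower half plane. -/
lemma log_one_sub_combination {w : ℂ} (hw : w.im < 0) :
    (Complex.log (1 - w) - Complex.log (1 - w⁻¹)) - (Complex.log (-w) - Complex.log (-w⁻¹)) =
      -Complex.log w - Real.pi * Complex.I := by
  have hw0 : w ≠ 0 := by rintro rfl; simp at hw
  have hneg : Complex.log (-w) = Complex.log w + Real.pi * Complex.I := by
    simp only [Complex.log, norm_neg, Complex.arg_neg_eq_arg_add_pi_of_im_neg hw]
    push_cast; ring
  have him : 0 < (-w).im := by simpa using hw
  have hinv_im : (-w)⁻¹.im < 0 := by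
    rw [Complex.inv_im]
    exact div_neg_of_neg_of_pos (by linarith)
      (Complex.normSq_pos.2 (neg_ne_zero.2 hw0))
  have harg : (-w).arg ≠ Real.pi := fun h ↦ by
    rw [Complex.arg_eq_pi_iff] at h
    exact him.ne' h.2
  have hinv : Complex.log (-w⁻¹) = -Complex.log (-w) := by
    rw [← Complex.log_inv _ harg, inv_neg]
  have hone_im : 0 < (1 - w).im := by simpa using hw
  have hmul : Complex.log (1 - w⁻¹) = Complex.log (1 - w) + Complex.log (-w)⁻¹ := by
    rw [← (Complex.log_mul_eq_add_log_iff _ _).2]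
    · congr 1
      field_simp
      ring
    · have h1 : 0 ≤ (1 - w).arg := Complex.arg_nonneg_iff.2 hone_im.le
      have h2 : (-w)⁻¹.arg < 0 := Complex.arg_neg_iff.2 hinv_im
      have h3 := Complex.neg_pi_lt_arg (-w)⁻¹
      have h4 := Complex.arg_le_pi (1 - w)
      constructor <;> linarith
    · intro h; simp [h] at hone_im
    · exact inv_ne_zero (neg_ne_zero.2 hw0)
  rw [hmul, hinv, Complex.log_inv _ harg, hneg]
  ring

/-- The tangent of half the angle whose sine is `t`. -/
noncomputable def halfTan (t : ℝ) : ℝ := t / (1 + Real.sqrt (1 - t ^ 2))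

lemma continuous_halfTan : Continuous halfTan := by
  unfold halfTan
  refine continuous_id.div (by fun_prop) fun t ↦ ?_
  positivity

lemma hasDerivAt_halfTan {t : ℝ} (ht : 0 < 1 - t ^ 2) :
    HasDerivAt halfTan (1 / (Real.sqrt (1 - t ^ 2) * (1 + Real.sqrt (1 - t ^ 2)))) t := by
  have h1 : HasDerivAt (fun t : ℝ ↦ 1 - t ^ 2) (-(2 * t)) t := by
    simpa using (hasDerivAt_pow 2 t).const_sub 1
  have h2 := (h1.sqrt ht.ne').const_add 1
  have hr := Real.sqrt_pos.2 ht
  have hsq := Real.sq_sqrt ht.le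
  have h3 := (hasDerivAt_id t).div h2 (by positivity)
  refine h3.congr_deriv ?_
  simp only [id]
  set r := Real.sqrt (1 - t ^ 2)
  field_simp
  linear_combination hsq

lemma halfTan_sub_mem_slitPlane {v : ℂ} (hv : v.im ≠ 0) (t : ℝ) :
    (halfTan t : ℂ) - v ∈ Complex.slitPlane := by
  right
  simpa using hv

lemma continuous_log_halfTan_sub {v : ℂ} (hv : v.im ≠ 0) :
    Continuous fun t : ℝ ↦ Complex.log (halfTan t - v) := by
  refine Continuous.clog ?_ (halfTan_sub_mem_slitPlane hv)
  exact (Complex.continuous_ofReal.comp continuous_halfTan).sub continuous_const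

/-- The arcsine kernel integrated against a continuous Cauchy kernel. -/
lemma intervalIntegrable_inv_sqrt_div_sub {z : ℂ} (hz : ∀ t ∈ Icc (0 : ℝ) 1, z - t ≠ 0) :
    IntervalIntegrable (fun t : ℝ ↦ ((1 / Real.sqrt (1 - t ^ 2) : ℝ) : ℂ) / (z - t))
      volume 0 1 := by
  have h1 : IntervalIntegrable (fun t : ℝ ↦ 1 / Real.sqrt (1 - t ^ 2)) volume 0 1 := by
    refine intervalIntegral.intervalIntegrable_deriv_of_nonneg
      (Real.continuous_arcsin.continuousOn) (fun x hx ↦ ?_) fun x _ ↦ by positivity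
    simp only [zero_le_one, min_eq_left, max_eq_right, mem_Ioo] at hx
    exact Real.hasDerivAt_arcsin (by linarith) (by linarith)
  have h2 : IntervalIntegrable (fun t : ℝ ↦ ((1 / Real.sqrt (1 - t ^ 2) : ℝ) : ℂ))
      volume 0 1 := by
    rw [intervalIntegrable_iff] at h1 ⊢
    exact h1.ofReal
  simp only [div_eq_mul_inv _ (z - _)]
  refine h2.mul_continuousOn ?_
  rw [uIcc_of_le zero_le_one]
  exact ContinuousOn.inv₀ (by fun_prop) hz

/-- The Cauchy transform of the arcsine kernel over `[0, 1]`, in the coordinate `w` with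
`w + w⁻¹ = 2 / z`. -/
lemma mul_integral_inv_sqrt_div_sub {z s w : ℂ} (hw : w.im < 0)
    (hz : ∀ t ∈ Icc (0 : ℝ) 1, z - t ≠ 0) (hzw : z * (w + w⁻¹) = 2)
    (hs : 2 * s = Complex.I * z * (w - w⁻¹)) :
    s * ∫ t in (0 : ℝ)..1, ((1 / Real.sqrt (1 - t ^ 2) : ℝ) : ℂ) / (z - t) =
      Real.pi - Complex.I * Complex.log w := by
  have hw0 : w ≠ 0 := by rintro rfl; simp at hw
  have hinv : w⁻¹.im ≠ 0 := by
    rw [Complex.inv_im]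
    exact div_ne_zero (by linarith) (Complex.normSq_pos.2 hw0).ne'
  have hz0 : z ≠ 0 := by rintro rfl; simp at hzw
  have key : ∫ t in (0 : ℝ)..1, s * (((1 / Real.sqrt (1 - t ^ 2) : ℝ) : ℂ) / (z - t)) =
      Complex.I * (Complex.log (halfTan 1 - w) - Complex.log (halfTan 1 - w⁻¹)) -
      Complex.I * (Complex.log (halfTan 0 - w) - Complex.log (halfTan 0 - w⁻¹)) := by
    refine intervalIntegral.integral_eq_sub_of_hasDerivAt_of_le zero_le_one
      (f := fun t : ℝ ↦
        Complex.I * (Complex.log (halfTan t - w) - Complex.log (halfTan t - w⁻¹)))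
      (continuous_const.mul ((continuous_log_halfTan_sub hw.ne).sub
        (continuous_log_halfTan_sub hinv))).continuousOn (fun t ht ↦ ?_)
      ((intervalIntegrable_inv_sqrt_div_sub hz).const_mul s)
    have ht' : 0 < 1 - t ^ 2 := by nlinarith [ht.1, ht.2]
    have hu := (hasDerivAt_halfTan ht').ofReal_comp
    have m1 := halfTan_sub_mem_slitPlane hw.ne t
    have m2 := halfTan_sub_mem_slitPlane hinv t
    refine ((((hu.sub_const w).clog_real m1).sub
      ((hu.sub_const w⁻¹).clog_real m2)).const_mul Complex.I).congr_deriv ?_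
    have n1 := Complex.slitPlane_ne_zero m1
    have n2 := Complex.slitPlane_ne_zero m2
    have n3 := hz t ⟨ht.1.le, ht.2.le⟩
    have hr := Real.sqrt_pos.2 ht'
    have hsq := Real.sq_sqrt ht'.le
    have hu_eq : halfTan t * (1 + Real.sqrt (1 - t ^ 2)) = t := by
      unfold halfTan; field_simp
    set r := Real.sqrt (1 - t ^ 2)
    set u := halfTan t
    have hr1 : ((1 : ℂ) + r) ≠ 0 := by
      exact_mod_cast (by positivity : (1 + r) ≠ 0)
    have hr0 : (r : ℂ) ≠ 0 := by exact_mod_cast hr.ne'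
    have hu_sq : (u ^ 2 + 1) * (1 + r) = 2 := by
      have : (u ^ 2 + 1) * (1 + r) * (1 + r) = 2 * (1 + r) := by
        linear_combination (u * (1 + r) + t) * hu_eq + hsq
      exact mul_right_cancel₀ (by positivity) this
    have hu_eq' : (u : ℂ) * (1 + r) = t := by exact_mod_cast hu_eq
    have hu_sq' : ((u : ℂ) ^ 2 + 1) * (1 + r) = 2 := by exact_mod_cast hu_sq
    have hprod : z * ((u - w) * (u - w⁻¹)) * (1 + r) = 2 * (z - t) := by
      have : w * w⁻¹ = 1 := mul_inv_cancel₀ hw0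
      linear_combination z * hu_sq' - u * (1 + r) * hzw + z * (1 + r) * this - 2 * hu_eq'
    push_cast
    generalize w⁻¹ = w' at *
    have hs' : s = Complex.I * z * (w - w') / 2 := by rw [← hs]; ring
    rw [hs']
    field_simp
    linear_combination (w' - w) * hprod
  rw [← intervalIntegral.integral_const_mul, key]
  have h1 : halfTan 1 = 1 := by simp [halfTan]
  have h0 : halfTan 0 = 0 := by simp [halfTan]
  rw [h1, h0]
  have := log_one_sub_combination hw
  simp only [Complex.ofReal_one, Complex.ofReal_zero, zero_sub]
  linear_combination Complex.I * this - Real.pi * Complex.I_mul_I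

lemma isPreconnected_compl_segment :
    IsPreconnected ({z : ℂ | z.im = 0 ∧ |z.re| ≤ 1}ᶜ) := by
  have h1 : IsPreconnected ({z : ℂ | 0 < z.im} ∪ {z : ℂ | 1 < z.re}) :=
    IsPreconnected.union (2 + Complex.I) (by simp) (by simp)
      (convex_halfSpace_im_gt 0).isPreconnected (convex_halfSpace_re_gt 1).isPreconnected
  have h2 : IsPreconnected (({z : ℂ | 0 < z.im} ∪ {z : ℂ | 1 < z.re}) ∪ {z : ℂ | z.im < 0}) :=
    IsPreconnected.union (2 - Complex.I) (by simp) (by simp)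
      h1 (convex_halfSpace_im_lt 0).isPreconnected
  have h3 : IsPreconnected ((({z : ℂ | 0 < z.im} ∪ {z : ℂ | 1 < z.re}) ∪ {z : ℂ | z.im < 0}) ∪
      {z : ℂ | z.re < -1}) :=
    IsPreconnected.union (-2 + Complex.I) (by simp) (by simp)
      h2 (convex_halfSpace_re_lt (-1)).isPreconnected
  convert h3 using 1
  ext z
  simp only [mem_compl_iff, mem_ofPred_eq, mem_union, abs_le]
  grind

/-- The inverse Joukowsky coordinate is real only on the segment `[-1, 1]`. -/
lemma im_ne_zero_of_mul_add_inv {z w : ℂ} (hz : ¬ (z.im = 0 ∧ |z.re| ≤ 1))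
    (hzw : z * (w + w⁻¹) = 2) : w.im ≠ 0 := by
  intro h
  apply hz
  obtain ⟨x, rfl⟩ : ∃ x : ℝ, w = x := ⟨w.re, Complex.ext rfl (by simpa using h)⟩
  have hx : x ≠ 0 := by rintro rfl; simp at hzw
  have hxC : (x : ℂ) ≠ 0 := by exact_mod_cast hx
  have hpos : (0 : ℝ) < x ^ 2 + 1 := by positivity
  have hz' : z = ((2 * x / (x ^ 2 + 1) : ℝ) : ℂ) := by
    have hne : (x : ℂ) ^ 2 + 1 ≠ 0 := by exact_mod_cast hpos.ne'
    push_cast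
    field_simp at hzw ⊢
    linear_combination hzw
  rw [hz']
  refine ⟨Complex.ofReal_im _, ?_⟩
  rw [Complex.ofReal_re, abs_le, le_div_iff₀ hpos, div_le_iff₀ hpos]
  constructor <;> nlinarith [sq_nonneg (x + 1), sq_nonneg (x - 1)]

lemma one_sub_I_mul_div_mul_inv_eq {z s : ℂ} (hz : z ≠ 0) (hs : s ^ 2 = z ^ 2 - 1) :
    ((1 - Complex.I * s) / z)⁻¹ = (1 + Complex.I * s) / z := by
  refine inv_eq_of_mul_eq_one_right ?_
  field_simp
  linear_combination hs - s ^ 2 * Complex.I_mul_I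

lemma im_one_sub_I_mul_div_neg (sq : ℂ → ℂ)
    (hsq_an : AnalyticOnNhd ℂ sq ({z : ℂ | z.im = 0 ∧ |z.re| ≤ 1}ᶜ))
    (hsq_sq : ∀ z ∈ ({z : ℂ | z.im = 0 ∧ |z.re| ≤ 1}ᶜ : Set ℂ), sq z ^ 2 = z ^ 2 - 1)
    (hsq_pos : ∀ x : ℝ, 1 < x → sq (x : ℂ) = ((Real.sqrt (x ^ 2 - 1) : ℝ) : ℂ))
    {z : ℂ} (hz : z ∈ ({z : ℂ | z.im = 0 ∧ |z.re| ≤ 1}ᶜ : Set ℂ)) :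
    ((1 - Complex.I * sq z) / z).im < 0 := by
  have hne : ∀ z ∈ ({z : ℂ | z.im = 0 ∧ |z.re| ≤ 1}ᶜ : Set ℂ), z ≠ 0 := by
    rintro z hz rfl
    simp at hz
  have hcont : ContinuousOn (fun z ↦ ((1 - Complex.I * sq z) / z).im)
      ({z : ℂ | z.im = 0 ∧ |z.re| ≤ 1}ᶜ) :=
    Complex.continuous_im.comp_continuousOn
      ((continuousOn_const.sub (continuousOn_const.mul hsq_an.continuousOn)).div
        continuousOn_id hne)
  have hmem2 : ((2 : ℝ) : ℂ) ∈ ({z : ℂ | z.im = 0 ∧ |z.re| ≤ 1}ᶜ : Set ℂ) := by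
    simp only [mem_compl_iff, mem_ofPred_eq, Complex.ofReal_im, Complex.ofReal_re]
    norm_num
  have h2 : ((1 - Complex.I * sq ((2 : ℝ) : ℂ)) / ((2 : ℝ) : ℂ)).im < 0 := by
    rw [hsq_pos 2 one_lt_two, Complex.div_ofReal_im]
    refine div_neg_of_neg_of_pos ?_ two_pos
    have : 0 < Real.sqrt (2 ^ 2 - 1) := Real.sqrt_pos.2 (by norm_num)
    simp only [Complex.sub_im, Complex.one_im, Complex.mul_im, Complex.I_re, Complex.I_im,
      Complex.ofReal_re, Complex.ofReal_im]
    linarith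
  by_contra! h
  obtain ⟨y, hy, hy0⟩ := isPreconnected_compl_segment.intermediate_value hmem2 hz hcont
    ⟨h2.le, h⟩
  have hy1 := hne y hy
  refine im_ne_zero_of_mul_add_inv hy ?_ hy0
  rw [one_sub_I_mul_div_mul_inv_eq hy1 (hsq_sq y hy)]
  field_simp
  ring

/-- The Cauchy integral of the logarithm of the step function reduces to `[0, 1]`. -/
lemma integral_log_step_div (c : ℝ) {z : ℂ} (hz : ∀ t ∈ Icc (0 : ℝ) 1, z - t ≠ 0) :
    ∫ t in (-1 : ℝ)..1,
      ((Real.log (if t < 0 then 1 else c ^ 2) / Real.sqrt (1 - t ^ 2) : ℝ) : ℂ) / (z - t) =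
    2 * Real.log c * ∫ t in (0 : ℝ)..1, ((1 / Real.sqrt (1 - t ^ 2) : ℝ) : ℂ) / (z - t) := by
  set f : ℝ → ℂ := fun t ↦
    ((Real.log (if t < 0 then 1 else c ^ 2) / Real.sqrt (1 - t ^ 2) : ℝ) : ℂ) / (z - t)
  have hneg : EqOn (fun _ ↦ 0) f (uIoo (-1) 0) := by
    intro t ht
    rw [uIoo_of_le (by norm_num)] at ht
    simp [f, ht.2]
  have hpos : EqOn (fun t : ℝ ↦
      2 * (Real.log c : ℂ) * (((1 / Real.sqrt (1 - t ^ 2) : ℝ) : ℂ) / (z - t))) f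
      (uIoo 0 1) := by
    intro t ht
    rw [uIoo_of_le zero_le_one] at ht
    simp only [f, if_neg ht.1.le.not_gt, Real.log_pow]
    push_cast
    ring
  rw [← intervalIntegral.integral_add_adjacent_intervals
      (intervalIntegrable_const.congr_uIoo hneg)
      (((intervalIntegrable_inv_sqrt_div_sub hz).const_mul _).congr_uIoo hpos),
    ← intervalIntegral.integral_congr_uIoo hneg, ← intervalIntegral.integral_congr_uIoo hpos,
    intervalIntegral.integral_const_mul]
  simp


theorem stmt17
    (c : ℝ) (hc : 0 < c)
    -- the branch of √(z²-1), analytic off [-1,1] and positive on (1,∞)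
    (sq : ℂ → ℂ)
    (hsq_an : AnalyticOnNhd ℂ sq ({z : ℂ | z.im = 0 ∧ |z.re| ≤ 1}ᶜ))
    (hsq_sq : ∀ z ∈ ({z : ℂ | z.im = 0 ∧ |z.re| ≤ 1}ᶜ : Set ℂ), sq z ^ 2 = z ^ 2 - 1)
    (hsq_pos : ∀ x : ℝ, 1 < x → sq (x : ℂ) = ((Real.sqrt (x ^ 2 - 1) : ℝ) : ℂ))
    -- the Szegő function of the step function Ξ_c (= 1 on [-1,0), = c² on [0,1])
    (D : ℂ → ℂ)
    (hD : ∀ z : ℂ, D z =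
      Complex.exp (sq z / (2 * (Real.pi : ℂ)) *
        ∫ t in (-1 : ℝ)..1,
          ((Real.log (if t < 0 then 1 else c ^ 2) / Real.sqrt (1 - t ^ 2) : ℝ) : ℂ) /
            (z - (t : ℂ)))) :
    -- explicit formula: D(z, Ξ_c) = c·exp(−λ·log((1 − i√(z²-1))/z)) with λ = i·log(c)/π
    ∀ z ∈ ({z : ℂ | z.im = 0 ∧ |z.re| ≤ 1}ᶜ : Set ℂ),
      D z = (c : ℂ) *
        Complex.exp (-(Complex.I * ((Real.log c / Real.pi : ℝ) : ℂ)) *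
          Complex.log ((1 - Complex.I * sq z) / z)) := by
  intro z hz
  have hz0 : z ≠ 0 := by
    rintro rfl
    simp at hz
  have hzt : ∀ t ∈ Icc (0 : ℝ) 1, z - t ≠ 0 := by
    intro t ht h
    apply hz
    rw [sub_eq_zero.1 h]
    exact ⟨Complex.ofReal_im t, by rw [Complex.ofReal_re, abs_of_nonneg ht.1]; exact ht.2⟩
  have him := im_one_sub_I_mul_div_neg sq hsq_an hsq_sq hsq_pos hz
  have hinv := one_sub_I_mul_div_mul_inv_eq hz0 (hsq_sq z hz)
  have hint := mul_integral_inv_sqrt_div_sub (s := sq z) him hzt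
    (by rw [hinv]; field_simp; ring)
    (by
      rw [hinv]
      field_simp
      linear_combination 2 * sq z * Complex.I_sq)
  have hpi : (Real.pi : ℂ) ≠ 0 := by exact_mod_cast Real.pi_ne_zero
  have hc' : (c : ℂ) = Complex.exp (Real.log c) := by
    rw [← Complex.ofReal_exp, Real.exp_log hc]
  rw [hD, integral_log_step_div c hzt]
  conv_rhs => rw [hc']
  rw [← Complex.exp_add]
  congr 1
  generalize (∫ t in (0 : ℝ)..1, ((1 / Real.sqrt (1 - t ^ 2) : ℝ) : ℂ) / (z - t)) = J at *
  generalize Complex.log ((1 - Complex.I * sq z) / z) = L at *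
  push_cast
  field_simp
  linear_combination (Real.log c : ℂ) * hint
end
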